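/- arXiv:2110.12026 — 2 statements merged into one kernel-verified Lean document; each statement's English description precedes it below -/
import Mathlib

section
/- Let u₀ : ℝⁿ → ℝ be a locally Lipschitz function (not necessarily proper) which is bounded from below and satisfies: for every M ∈ ℝ there is a constant c(M) such that √(1+|Du₀(x)|²) ≤ c(M) for almost every x with u₀(x) < M. Let u₁, u₂ : ℝⁿ × (0,T] → ℝ be two smooth solutions of the graphical mean curvature flow which both satisfy the curvature condition with the same constant c > 0, and which both attain the initial data u₀, i.e., uᵢ(·,t) → u₀ locally uniformly as t → 0⁺ for i = 1,2. Then u₁ = u₂ on ℝⁿ × (0,T]. -/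
open Real Filter Set

noncomputable section

/-- The `i`-th spatial partial derivative of `f : ℝⁿ → ℝ`. -/
def pd (n : ℕ) (f : EuclideanSpace ℝ (Fin n) → ℝ) (i : Fin n)
    (x : EuclideanSpace ℝ (Fin n)) : ℝ :=
  fderiv ℝ f x (EuclideanSpace.single i 1)

/-- The second spatial partial derivative `∂ᵢ∂ⱼ f`. -/
def pd2 (n : ℕ) (f : EuclideanSpace ℝ (Fin n) → ℝ) (i j : Fin n)
    (x : EuclideanSpace ℝ (Fin n)) : ℝ :=
  pd n (fun y => pd n f j y) i x

/-- The squared norm `|Df|²` of the spatial gradient. -/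
def gradSq (n : ℕ) (f : EuclideanSpace ℝ (Fin n) → ℝ)
    (x : EuclideanSpace ℝ (Fin n)) : ℝ :=
  ∑ i, (pd n f i x) ^ 2

/-- The right-hand side of the graphical mean curvature flow equation:
`Σ_{i,j} (δ_{ij} − ∂ᵢf ∂ⱼf/(1+|Df|²)) ∂ᵢ∂ⱼf`. -/
def mcfRHS (n : ℕ) (f : EuclideanSpace ℝ (Fin n) → ℝ)
    (x : EuclideanSpace ℝ (Fin n)) : ℝ :=
  ∑ i, ∑ j, ((if i = j then (1 : ℝ) else 0)
    - pd n f i x * pd n f j x / (1 + gradSq n f x)) * pd2 n f i j x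

/-- `u : ℝⁿ × S → ℝ` (curried, space then time) solves the graphical mean
curvature flow on the time set `S`. -/
def IsMCFSolution (n : ℕ) (u : EuclideanSpace ℝ (Fin n) → ℝ → ℝ) (S : Set ℝ) : Prop :=
  ∀ x, ∀ t ∈ S, deriv (fun s => u x s) t = mcfRHS n (fun y => u y t) x

/-- The curvature condition `v hⁱⱼ ≥ −c δⁱⱼ` for the graph of `u(·,t)`:
`Σ_{i,j} (Σ_l (δ_{il} − ∂ᵢu ∂ₗu/(1+|Du|²)) ∂ₗ∂ⱼu) ξᵢ ξⱼ ≥ −c |ξ|²` for all `ξ`. -/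
def CurvCond (n : ℕ) (u : EuclideanSpace ℝ (Fin n) → ℝ → ℝ) (S : Set ℝ) (c : ℝ) : Prop :=
  ∀ x, ∀ t ∈ S, ∀ ξ : Fin n → ℝ,
    ∑ i, ∑ j, (∑ l, ((if i = l then (1 : ℝ) else 0)
        - pd n (fun y => u y t) i x * pd n (fun y => u y t) l x
          / (1 + gradSq n (fun y => u y t) x))
      * pd2 n (fun y => u y t) l j x) * ξ i * ξ j ≥ -c * ∑ i, (ξ i) ^ 2

open Matrix in
/-- The Frobenius pairing `Σ_{i,j} N i j * D i j`. -/
def frob {n : ℕ} (N D : Matrix (Fin n) (Fin n) ℝ) : ℝ := ∑ i, ∑ j, N i j * D i j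

open Matrix in
/-- The inverse metric `δ - p ⊗ p / (1 + |p|²)` of a graph with slope `p`. -/
def invMetric {n : ℕ} (p : Fin n → ℝ) : Matrix (Fin n) (Fin n) ℝ :=
  1 - (1 + p ⬝ᵥ p)⁻¹ • vecMulVec p p

namespace frob
open Matrix

variable {n : ℕ} (N N' D D' : Matrix (Fin n) (Fin n) ℝ) (r : ℝ) (p q : Fin n → ℝ)

lemma add_right : frob N (D + D') = frob N D + frob N D' := by
  simp [frob, mul_add, Finset.sum_add_distrib]

lemma sub_right : frob N (D - D') = frob N D - frob N D' := by
  simp [frob, mul_sub, Finset.sum_sub_distrib]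

lemma sub_left : frob (N - N') D = frob N D - frob N' D := by
  simp [frob, sub_mul, Finset.sum_sub_distrib]

lemma smul_right : frob N (r • D) = r * frob N D := by
  simp only [frob, Matrix.smul_apply, smul_eq_mul, Finset.mul_sum]
  refine Finset.sum_congr rfl fun i _ => Finset.sum_congr rfl fun j _ => by ring

lemma smul_left : frob (r • N) D = r * frob N D := by
  simp only [frob, Matrix.smul_apply, smul_eq_mul, Finset.mul_sum]
  refine Finset.sum_congr rfl fun i _ => Finset.sum_congr rfl fun j _ => by ring

lemma vecMulVec_left : frob (vecMulVec p q) D = p ⬝ᵥ D *ᵥ q := by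
  simp only [frob, vecMulVec_apply, dotProduct, mulVec, Finset.mul_sum]
  refine Finset.sum_congr rfl fun i _ => Finset.sum_congr rfl fun j _ => by ring

lemma one_left : frob 1 D = D.trace := by
  simp [frob, Matrix.one_apply, Matrix.trace]

lemma sum_left {ι : Type*} (s : Finset ι) (F : ι → Matrix (Fin n) (Fin n) ℝ) :
    frob (∑ k ∈ s, F k) D = ∑ k ∈ s, frob (F k) D := by
  simp only [frob, Matrix.sum_apply, Finset.sum_mul]
  rw [Finset.sum_comm]
  conv_rhs => rw [Finset.sum_comm]
  rw [Finset.sum_comm]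
  refine Finset.sum_congr rfl fun i _ => ?_
  rw [Finset.sum_comm]

lemma nonneg_of_posSemidef {N D : Matrix (Fin n) (Fin n) ℝ} (hN : N.PosSemidef)
    (hD : ∀ v, 0 ≤ v ⬝ᵥ D *ᵥ v) : 0 ≤ frob N D := by
  obtain ⟨m, a, rfl⟩ := Matrix.posSemidef_iff_eq_sum_vecMulVec.mp hN
  rw [sum_left]
  refine Finset.sum_nonneg fun k _ => ?_
  rw [vecMulVec_left]
  simpa using hD (a k)

lemma invMetric_one : frob (invMetric p) 1 = n - p ⬝ᵥ p / (1 + p ⬝ᵥ p) := by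
  rw [invMetric, sub_left, smul_left, one_left, vecMulVec_left]
  simp [Matrix.trace_one, div_eq_inv_mul]

lemma invMetric_vecMulVec :
    frob (invMetric p) (vecMulVec q q) = q ⬝ᵥ q - (p ⬝ᵥ q) ^ 2 / (1 + p ⬝ᵥ p) := by
  rw [invMetric, sub_left, smul_left, one_left, vecMulVec_left, Matrix.trace_vecMulVec,
    Matrix.vecMulVec_mulVec]
  simp only [op_smul_eq_smul, dotProduct_smul, smul_eq_mul, dotProduct_comm q p]
  ring

end frob

section LinearAlgebra
open Matrix

variable {n : ℕ}

lemma dotProduct_self_nonneg' (p : Fin n → ℝ) : 0 ≤ p ⬝ᵥ p :=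
  Finset.sum_nonneg fun i _ => mul_self_nonneg (p i)

lemma dotProduct_sq_le (p q : Fin n → ℝ) : (p ⬝ᵥ q) ^ 2 ≤ (p ⬝ᵥ p) * (q ⬝ᵥ q) := by
  have := Finset.sum_mul_sq_le_sq_mul_sq Finset.univ p q
  simpa [dotProduct, sq] using this

lemma abs_dotProduct_le {p q : Fin n → ℝ} {P Q : ℝ} (hP : 0 ≤ P) (hQ : 0 ≤ Q)
    (hp : p ⬝ᵥ p ≤ P ^ 2) (hq : q ⬝ᵥ q ≤ Q ^ 2) : |p ⬝ᵥ q| ≤ P * Q := by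
  apply abs_le_of_sq_le_sq _ (mul_nonneg hP hQ)
  rw [mul_pow]
  exact (dotProduct_sq_le p q).trans
    (mul_le_mul hp hq (dotProduct_self_nonneg' q) (sq_nonneg P))

lemma invMetric_quadForm (p v : Fin n → ℝ) :
    v ⬝ᵥ invMetric p *ᵥ v = v ⬝ᵥ v - (p ⬝ᵥ v) ^ 2 / (1 + p ⬝ᵥ p) := by
  rw [invMetric, sub_mulVec, smul_mulVec, vecMulVec_mulVec, one_mulVec, dotProduct_sub,
    dotProduct_smul]
  simp only [op_smul_eq_smul, dotProduct_smul, smul_eq_mul, dotProduct_comm v p]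
  ring

lemma invMetric_isHermitian (p : Fin n → ℝ) : (invMetric p).IsHermitian := by
  ext i j
  simp only [invMetric, conjTranspose_apply, Matrix.sub_apply, Matrix.smul_apply, vecMulVec_apply,
    Matrix.one_apply, smul_eq_mul, star_trivial, mul_comm (p j), eq_comm (a := j)]

lemma invMetric_posSemidef (p : Fin n → ℝ) : (invMetric p).PosSemidef := by
  refine PosSemidef.of_dotProduct_mulVec_nonneg (invMetric_isHermitian p) fun v => ?_
  rw [star_trivial, invMetric_quadForm, sub_nonneg,
    div_le_iff₀ (by linarith [dotProduct_self_nonneg' p])]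
  nlinarith [dotProduct_sq_le p v, dotProduct_self_nonneg' v]

/-- Perturbing the slope `q / a` by `r / a` and steepening it to `q / b` changes the inverse metric
in a one-sided way, up to a small multiplicative error. -/
lemma invMetric_sub_smul_posSemidef {a b Q ρ δ κ : ℝ} {q r : Fin n → ℝ} (hδ : 0 < δ)
    (ha : δ ≤ a) (hb : 0 < b) (hba : b ≤ a) (hQ : 0 ≤ Q) (hρ : 0 ≤ ρ) (hρ1 : ρ ≤ 1)
    (hq : q ⬝ᵥ q ≤ Q ^ 2) (hr : r ⬝ᵥ r ≤ ρ ^ 2)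
    (hκ : κ = 2 * ρ * (2 * Q + 1) / δ ^ 2 * (1 + Q ^ 2 / δ ^ 2)) (hκ1 : κ ≤ 1) :
    (invMetric (a⁻¹ • (q + r)) - (1 - κ) • invMetric (b⁻¹ • q)).PosSemidef := by
  have ha0 : 0 < a := hδ.trans_le ha
  refine PosSemidef.of_dotProduct_mulVec_nonneg ?_ fun v => ?_
  · refine (invMetric_isHermitian _).sub ?_
    have := invMetric_isHermitian (b⁻¹ • q)
    rw [IsHermitian, conjTranspose_smul, this.eq, star_trivial]
  rw [star_trivial, sub_mulVec, smul_mulVec, dotProduct_sub, dotProduct_smul, invMetric_quadForm,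
    invMetric_quadForm, smul_eq_mul]
  set V := v ⬝ᵥ v with hV
  set d := (q + r) ⬝ᵥ v with hd
  set e := q ⬝ᵥ v with he
  set f := r ⬝ᵥ v with hf
  set s := (q + r) ⬝ᵥ (q + r) with hs
  set m := q ⬝ᵥ q with hm
  have hV0 : 0 ≤ V := dotProduct_self_nonneg' v
  have hs0 : 0 ≤ s := dotProduct_self_nonneg' _
  have hm0 : 0 ≤ m := dotProduct_self_nonneg' _
  have hdef : d = e + f := by simp [hd, he, hf, add_dotProduct]
  have hsm : s = m + 2 * (q ⬝ᵥ r) + r ⬝ᵥ r := by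
    simp [hs, hm, add_dotProduct, dotProduct_add, dotProduct_comm r q]; ring
  have hqr := abs_le.1 (abs_dotProduct_le hQ hρ hq hr)
  have hVs : V ≤ (√V) ^ 2 := (Real.sq_sqrt hV0).ge
  have he' : |e| ≤ Q * √V := abs_dotProduct_le hQ (Real.sqrt_nonneg _) hq hVs
  have hf' : |f| ≤ ρ * √V := abs_dotProduct_le hρ (Real.sqrt_nonneg _) hr hVs
  have hVV : √V * √V = V := Real.mul_self_sqrt hV0
  have hef : |e * f| ≤ Q * ρ * V := by
    rw [abs_mul]
    calc |e| * |f| ≤ (Q * √V) * (ρ * √V) := by gcongr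
      _ = Q * ρ * (√V * √V) := by ring
      _ = _ := by rw [hVV]
  have hff : f ^ 2 ≤ ρ ^ 2 * V := by
    rw [← sq_abs]
    calc |f| ^ 2 ≤ (ρ * √V) ^ 2 := by gcongr
      _ = ρ ^ 2 * (√V * √V) := by ring
      _ = _ := by rw [hVV]
  have hee : e ^ 2 ≤ m * V := dotProduct_sq_le q v
  have hρρ : ρ ^ 2 ≤ ρ := by nlinarith
  have hde : d ^ 2 - e ^ 2 ≤ ρ * (2 * Q + 1) * V := by
    have := (abs_le.1 hef).2
    rw [hdef]; nlinarith
  have hms : m - s ≤ ρ * (2 * Q + 1) := by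
    have := dotProduct_self_nonneg' r
    nlinarith [hqr.1]
  have e1 : (a⁻¹ • (q + r) ⬝ᵥ v) ^ 2 / (1 + a⁻¹ • (q + r) ⬝ᵥ a⁻¹ • (q + r)) = d ^ 2 / (a ^ 2 + s) := by
    simp only [smul_dotProduct, dotProduct_smul, smul_eq_mul, ← hs, ← hd]
    field_simp
  have e2 : (b⁻¹ • q ⬝ᵥ v) ^ 2 / (1 + b⁻¹ • q ⬝ᵥ b⁻¹ • q) = e ^ 2 / (b ^ 2 + m) := by
    simp only [smul_dotProduct, dotProduct_smul, smul_eq_mul, ← hm, ← he]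
    field_simp
  rw [e1, e2]
  have hA : 0 < a ^ 2 + s := by positivity
  have hB : 0 < b ^ 2 + m := by positivity
  have hC : 0 < a ^ 2 + m := by positivity
  have hδa : δ ^ 2 ≤ a ^ 2 := by gcongr
  set L := ρ * (2 * Q + 1) with hL
  have hL0 : 0 ≤ L := by positivity
  have k1 : d ^ 2 / (a ^ 2 + s) - e ^ 2 / (a ^ 2 + m) ≤ 2 * L / δ ^ 2 * V := by
    have hX : d ^ 2 / (a ^ 2 + s) - e ^ 2 / (a ^ 2 + m)
        = (d ^ 2 - e ^ 2 + e ^ 2 / (a ^ 2 + m) * (m - s)) / (a ^ 2 + s) := by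
      field_simp; ring
    have hE : e ^ 2 / (a ^ 2 + m) ≤ V := by
      rw [div_le_iff₀ hC]; linarith [mul_nonneg hV0 (sq_nonneg a)]
    have hE0 : 0 ≤ e ^ 2 / (a ^ 2 + m) := by positivity
    have h2 : e ^ 2 / (a ^ 2 + m) * (m - s) ≤ V * L := by
      calc _ ≤ e ^ 2 / (a ^ 2 + m) * L := by gcongr
        _ ≤ V * L := by gcongr
    rw [hX]
    calc _ ≤ (2 * L * V) / (a ^ 2 + s) := by gcongr; linarith
      _ ≤ (2 * L * V) / δ ^ 2 := by gcongr; linarith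
      _ = _ := by ring
  have k2 : e ^ 2 / (a ^ 2 + m) ≤ e ^ 2 / (b ^ 2 + m) := by gcongr
  -- the metric at slope `q / a` is uniformly elliptic
  have k3 : V ≤ (1 + Q ^ 2 / δ ^ 2) * (V - e ^ 2 / (a ^ 2 + m)) := by
    have h3 : a ^ 2 / (a ^ 2 + m) * V ≤ V - e ^ 2 / (a ^ 2 + m) := by
      rw [div_mul_eq_mul_div, le_sub_iff_add_le, ← add_div, div_le_iff₀ hC]
      linarith
    have h4 : 1 ≤ (1 + Q ^ 2 / δ ^ 2) * (a ^ 2 / (a ^ 2 + m)) := by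
      have : m / a ^ 2 ≤ Q ^ 2 / δ ^ 2 := by gcongr
      calc (1 : ℝ) = (1 + m / a ^ 2) * (a ^ 2 / (a ^ 2 + m)) := by field_simp
        _ ≤ _ := by gcongr
    calc V = 1 * V := by ring
      _ ≤ (1 + Q ^ 2 / δ ^ 2) * (a ^ 2 / (a ^ 2 + m)) * V := by gcongr
      _ = (1 + Q ^ 2 / δ ^ 2) * (a ^ 2 / (a ^ 2 + m) * V) := by ring
      _ ≤ _ := by gcongr
  have k4 : 2 * L / δ ^ 2 * V ≤ κ * (V - e ^ 2 / (a ^ 2 + m)) := by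
    calc _ ≤ 2 * L / δ ^ 2 * ((1 + Q ^ 2 / δ ^ 2) * (V - e ^ 2 / (a ^ 2 + m))) := by gcongr
      _ = _ := by rw [hκ, hL]; ring
  linarith [mul_le_mul_of_nonneg_left k2 (sub_nonneg.2 hκ1)]

/-- The curvature condition bounds the Hessian from below by the induced metric. -/
lemma hessian_lower_bound {c : ℝ} (hc : 0 < c) (p : Fin n → ℝ) (A : Matrix (Fin n) (Fin n) ℝ)
    (hA : A.IsSymm)
    (h : ∀ ξ : Fin n → ℝ, -c * (ξ ⬝ᵥ ξ) ≤ ξ ⬝ᵥ (invMetric p * A) *ᵥ ξ) (v : Fin n → ℝ) :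
    -c * (v ⬝ᵥ v + (p ⬝ᵥ v) ^ 2) ≤ v ⬝ᵥ A *ᵥ v := by
  have hform : ∀ ξ : Fin n → ℝ, ξ ⬝ᵥ (invMetric p * A) *ᵥ ξ
      = ξ ⬝ᵥ A *ᵥ ξ - (p ⬝ᵥ ξ) * (p ⬝ᵥ A *ᵥ ξ) / (1 + p ⬝ᵥ p) := by
    intro ξ
    rw [← mulVec_mulVec, invMetric, sub_mulVec, smul_mulVec, vecMulVec_mulVec, one_mulVec,
      dotProduct_sub, dotProduct_smul]
    simp only [op_smul_eq_smul, dotProduct_smul, smul_eq_mul, dotProduct_comm ξ p]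
    ring
  have hsymm : p ⬝ᵥ A *ᵥ v = v ⬝ᵥ A *ᵥ p := by
    rw [dotProduct_mulVec, ← mulVec_transpose, hA.eq, dotProduct_comm]
  set P := p ⬝ᵥ p with hP
  have hP0 : 0 ≤ P := dotProduct_self_nonneg' p
  rcases hP0.eq_or_lt with h0 | hPpos
  · have hp : p = 0 := dotProduct_self_eq_zero.1 h0.symm
    have := h v
    rw [hform] at this
    simpa [hp] using this
  set t := p ⬝ᵥ v with ht
  set σ := t / P with hσ
  have htP : t = σ * P := by rw [hσ]; field_simp
  set μ := 2 * (1 + P) / (2 + P) with hμ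
  have h1 := h (v + ((μ - 1) * σ) • p)
  have h2 := h p
  rw [hform] at h1 h2
  simp only [mulVec_add, mulVec_smul, add_dotProduct, dotProduct_add, smul_dotProduct,
    dotProduct_smul, smul_eq_mul, hsymm, ← hP, ← ht, dotProduct_comm v p] at h1 h2
  set w := v ⬝ᵥ A *ᵥ p
  set z := v ⬝ᵥ A *ᵥ v
  set y := p ⬝ᵥ A *ᵥ p
  set V := v ⬝ᵥ v
  rw [htP] at h1 ⊢
  have hy : -c * P * (1 + P) ≤ y := by
    have : y - P * y / (1 + P) = y / (1 + P) := by field_simp; ring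
    rw [this, le_div_iff₀ (by positivity)] at h2
    exact h2
  have hid : z + (μ - 1) * σ * w + (μ - 1) * σ * (w + (μ - 1) * σ * y)
      - (σ * P + (μ - 1) * σ * P) * (w + (μ - 1) * σ * y) / (1 + P)
      = z - (1 - μ ^ 2 / (1 + P)) * σ ^ 2 * y := by
    rw [hμ]; field_simp; ring
  have hco : 0 ≤ 1 - μ ^ 2 / (1 + P) := by
    have : 1 - μ ^ 2 / (1 + P) = P ^ 2 / (2 + P) ^ 2 := by rw [hμ]; field_simp; ring
    rw [this]; positivity
  have h3 := mul_le_mul_of_nonneg_left hy (mul_nonneg hco (sq_nonneg σ))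
  have hid2 : (1 - μ ^ 2 / (1 + P)) * σ ^ 2 * (-c * P * (1 + P))
      = -c * σ ^ 2 * P * (1 + P - μ ^ 2) := by field_simp
  have h1' : -c * (V + (μ - 1) * σ * (σ * P) + (μ - 1) * σ * (σ * P + (μ - 1) * σ * P))
      ≤ z - (1 - μ ^ 2 / (1 + P)) * σ ^ 2 * y := by
    rw [← hid]; linarith
  nlinarith

/-- The mean curvature is bounded below by the curvature condition. -/
lemma frob_invMetric_lower_bound {c : ℝ} (p : Fin n → ℝ) (A : Matrix (Fin n) (Fin n) ℝ)
    (hA : A.IsSymm)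
    (h : ∀ ξ : Fin n → ℝ, -c * (ξ ⬝ᵥ ξ) ≤ ξ ⬝ᵥ (invMetric p * A) *ᵥ ξ) :
    -c * n ≤ frob (invMetric p) A := by
  have : frob (invMetric p) A = (invMetric p * A).trace := by
    simp only [frob, Matrix.trace, Matrix.diag, Matrix.mul_apply]
    refine Finset.sum_congr rfl fun i _ => Finset.sum_congr rfl fun j _ => by rw [hA.apply]
  rw [this, Matrix.trace]
  calc -c * n = ∑ _i : Fin n, -c := by simp; ring
    _ ≤ _ := Finset.sum_le_sum fun i _ => by
      have := h (Pi.single i 1)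
      simpa using this

set_option maxHeartbeats 1000000 in
/-- The pointwise differential inequality at a maximum point of the doubled function: here
`a = exp (-u₁)`, `b = exp (-u₂)`, and `p₁, A₁, p₂, A₂` are gradients and Hessians of `u₁, u₂`. -/
lemma doubling_inequality {a b β ε κ c Q ρ : ℝ} {p₁ p₂ q r : Fin n → ℝ}
    {A₁ A₂ : Matrix (Fin n) (Fin n) ℝ}
    (hb : 0 < b) (hba : b ≤ a) (hc : 0 < c) (hβ : 0 ≤ β) (hε : 0 ≤ ε) (hκ : 0 ≤ κ) (hκ1 : κ ≤ 1)
    (hQ : 0 ≤ Q) (hρ : 0 ≤ ρ)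
    (hq : q ⬝ᵥ q ≤ Q ^ 2) (hr : r ⬝ᵥ r ≤ ρ ^ 2)
    (hp₁ : p₁ = a⁻¹ • (q + r)) (hp₂ : p₂ = b⁻¹ • q)
    (hess : ∀ ξ η : Fin n → ℝ, a * ((p₁ ⬝ᵥ ξ) ^ 2 - ξ ⬝ᵥ A₁ *ᵥ ξ) - b * ((p₂ ⬝ᵥ η) ^ 2 - η ⬝ᵥ A₂ *ᵥ η)
      ≤ β * ((ξ - η) ⬝ᵥ (ξ - η)) + 2 * ε * (ξ ⬝ᵥ ξ))
    (hcurv : ∀ v : Fin n → ℝ, -c * (v ⬝ᵥ v + (p₁ ⬝ᵥ v) ^ 2) ≤ v ⬝ᵥ A₁ *ᵥ v)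
    (hN : (invMetric p₁ - (1 - κ) • invMetric p₂).PosSemidef) :
    -a * frob (invMetric p₁) A₁ + b * frob (invMetric p₂) A₂
      ≤ (2 * c + 1) * (a - b) + κ * (n * β + c * n * a + (1 + c) * a) + 2 * ε * n
        + 2 * (1 + c) * (Q * ρ) / a := by
  have ha : 0 < a := hb.trans_le hba
  set X := a • (vecMulVec p₁ p₁ - A₁) with hX
  set Y := b • (vecMulVec p₂ p₂ - A₂) with hY
  set U := a • (c • (1 : Matrix (Fin n) (Fin n) ℝ) + (1 + c) • vecMulVec p₁ p₁) with hU
  have qf : ∀ p v : Fin n → ℝ, v ⬝ᵥ vecMulVec p p *ᵥ v = (p ⬝ᵥ v) ^ 2 := by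
    intro p v
    rw [vecMulVec_mulVec]
    simp [dotProduct_comm v p]; ring
  have hXv : ∀ v, v ⬝ᵥ X *ᵥ v = a * ((p₁ ⬝ᵥ v) ^ 2 - v ⬝ᵥ A₁ *ᵥ v) := by
    intro v; rw [hX, smul_mulVec, dotProduct_smul, sub_mulVec, dotProduct_sub, qf]; rfl
  have hYv : ∀ v, v ⬝ᵥ Y *ᵥ v = b * ((p₂ ⬝ᵥ v) ^ 2 - v ⬝ᵥ A₂ *ᵥ v) := by
    intro v; rw [hY, smul_mulVec, dotProduct_smul, sub_mulVec, dotProduct_sub, qf]; rfl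
  have i1 : 0 ≤ frob (invMetric p₂) (Y + (2 * ε) • 1 - X) := by
    refine frob.nonneg_of_posSemidef (invMetric_posSemidef _) fun v => ?_
    have := hess v v
    rw [sub_mulVec, add_mulVec, dotProduct_sub, dotProduct_add, hXv, hYv, smul_mulVec, one_mulVec,
      dotProduct_smul, smul_eq_mul]
    simp only [sub_self, dotProduct_zero, mul_zero] at this
    linarith
  have i2 : 0 ≤ frob (invMetric p₂) (Y + β • 1) := by
    refine frob.nonneg_of_posSemidef (invMetric_posSemidef _) fun v => ?_
    have := hess 0 v
    rw [add_mulVec, dotProduct_add, hYv, smul_mulVec, one_mulVec, dotProduct_smul, smul_eq_mul]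
    simp only [zero_sub, dotProduct_zero, mul_zero, mulVec_zero, neg_dotProduct,
      dotProduct_neg] at this
    linarith
  have i3 : 0 ≤ frob (invMetric p₁ - (1 - κ) • invMetric p₂) (U - X) := by
    refine frob.nonneg_of_posSemidef hN fun v => ?_
    have := mul_le_mul_of_nonneg_left (hcurv v) ha.le
    rw [sub_mulVec, dotProduct_sub, hXv, hU, smul_mulVec, add_mulVec, smul_mulVec, smul_mulVec,
      one_mulVec, dotProduct_smul, dotProduct_add, dotProduct_smul, dotProduct_smul, qf]
    simp only [smul_eq_mul]
    linarith
  set g₁A := frob (invMetric p₁) A₁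
  set g₂A := frob (invMetric p₂) A₂
  set h₁ := p₁ ⬝ᵥ p₁ / (1 + p₁ ⬝ᵥ p₁) with hh₁
  set h₂ := p₂ ⬝ᵥ p₂ / (1 + p₂ ⬝ᵥ p₂) with hh₂
  have self : ∀ p : Fin n → ℝ, p ⬝ᵥ p - (p ⬝ᵥ p) ^ 2 / (1 + p ⬝ᵥ p) = p ⬝ᵥ p / (1 + p ⬝ᵥ p) := by
    intro p
    have := dotProduct_self_nonneg' p
    field_simp; ring
  set k := p₁ ⬝ᵥ p₁ - (p₂ ⬝ᵥ p₁) ^ 2 / (1 + p₂ ⬝ᵥ p₂) with hk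
  have f1X : frob (invMetric p₁) X = a * (h₁ - g₁A) := by
    rw [hX, frob.smul_right, frob.sub_right, frob.invMetric_vecMulVec, self]
  have f2Y : frob (invMetric p₂) Y = b * (h₂ - g₂A) := by
    rw [hY, frob.smul_right, frob.sub_right, frob.invMetric_vecMulVec, self]
  set x₂ := frob (invMetric p₂) X with hx₂
  have f1U : frob (invMetric p₁) U = a * (c * (n - h₁) + (1 + c) * h₁) := by
    rw [hU, frob.smul_right, frob.add_right, frob.smul_right, frob.smul_right,
      frob.invMetric_vecMulVec, frob.invMetric_one, self]
  have f2U : frob (invMetric p₂) U = a * (c * (n - h₂) + (1 + c) * k) := by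
    rw [hU, frob.smul_right, frob.add_right, frob.smul_right, frob.smul_right,
      frob.invMetric_vecMulVec, frob.invMetric_one]
  rw [frob.sub_left, frob.smul_left, frob.sub_right, frob.sub_right, f1X, f1U, f2U, ← hx₂] at i3
  rw [frob.sub_right, frob.add_right, f2Y, frob.smul_right, frob.invMetric_one, ← hh₂, ← hx₂] at i1
  rw [frob.add_right, f2Y, frob.smul_right, frob.invMetric_one, ← hh₂] at i2
  have hk' : b ^ 2 * h₂ - 2 * (Q * ρ) ≤ a ^ 2 * k := by
    set m := q ⬝ᵥ q with hm
    have hm0 : 0 ≤ m := dotProduct_self_nonneg' q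
    have hrr := dotProduct_self_nonneg' r
    have hqr := abs_le.1 (abs_dotProduct_le hQ hρ hq hr)
    set s := q ⬝ᵥ r with hs
    have hB : 0 < b ^ 2 + m := by positivity
    have e1 : b ^ 2 * h₂ = b ^ 2 * m / (b ^ 2 + m) := by
      rw [hh₂, hp₂]
      simp only [smul_dotProduct, dotProduct_smul, smul_eq_mul, ← hm]
      field_simp
    have e2 : a ^ 2 * k = (m + 2 * s + r ⬝ᵥ r) - (m + s) ^ 2 / (b ^ 2 + m) := by
      rw [hk, hp₁, hp₂]
      simp only [smul_dotProduct, dotProduct_smul, smul_eq_mul, dotProduct_add, add_dotProduct,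
        dotProduct_comm r q, ← hm, ← hs]
      field_simp
      ring
    have hcs : s ^ 2 ≤ m * (r ⬝ᵥ r) := dotProduct_sq_le q r
    have e3 : a ^ 2 * k - b ^ 2 * h₂
        = 2 * s * (b ^ 2 / (b ^ 2 + m)) + (r ⬝ᵥ r - s ^ 2 / (b ^ 2 + m)) := by
      rw [e1, e2]; field_simp; ring
    have e4 : 0 ≤ r ⬝ᵥ r - s ^ 2 / (b ^ 2 + m) := by
      rw [sub_nonneg, div_le_iff₀ hB]; linarith [mul_nonneg hrr (sq_nonneg b)]
    have e5 : b ^ 2 / (b ^ 2 + m) ≤ 1 := by rw [div_le_one hB]; linarith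
    have e6 : 0 ≤ b ^ 2 / (b ^ 2 + m) := by positivity
    have e7 : 0 ≤ Q * ρ := by positivity
    linarith [mul_le_mul_of_nonneg_right hqr.1 e6, mul_le_mul_of_nonneg_left e5 e7]
  have hh₂0 : 0 ≤ h₂ := by have := dotProduct_self_nonneg' p₂; positivity
  have hh₂1 : h₂ ≤ 1 := by
    have := dotProduct_self_nonneg' p₂
    rw [hh₂, div_le_one (by linarith)]; linarith
  have hn : (0 : ℝ) ≤ n := Nat.cast_nonneg n
  clear_value x₂ g₁A g₂A h₁ h₂ k
  have hak : b ^ 2 / a * h₂ - 2 * (Q * ρ) / a ≤ a * k := by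
    rw [div_mul_eq_mul_div, ← sub_div, div_le_iff₀ ha]; linarith
  have j1 : (1 - κ) * (x₂ - b * (h₂ - g₂A)) ≤ 2 * ε * n := by
    have : x₂ - b * (h₂ - g₂A) ≤ 2 * ε * n := by
      linarith [mul_nonneg hε (mul_nonneg zero_le_two hh₂0)]
    calc _ ≤ (1 - κ) * (2 * ε * n) :=
          mul_le_mul_of_nonneg_left this (sub_nonneg.2 hκ1)
      _ ≤ _ := by linarith [mul_nonneg hκ (mul_nonneg hε hn)]
  have j2 : κ * -(b * (h₂ - g₂A)) ≤ κ * (n * β) := by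
    gcongr; linarith [mul_nonneg hβ hh₂0]
  have j3 : (1 - κ) * (1 + c) * (b ^ 2 / a * h₂ - 2 * (Q * ρ) / a) ≤ (1 - κ) * (1 + c) * (a * k) := by
    have : 0 ≤ 1 - κ := by linarith
    gcongr
  have j4 : (1 - κ) * (1 + c) * (2 * (Q * ρ) / a) ≤ 2 * (1 + c) * (Q * ρ) / a := by
    have h4 : 0 ≤ (1 + c) * (2 * (Q * ρ) / a) := by positivity
    have : 2 * (1 + c) * (Q * ρ) / a = (1 + c) * (2 * (Q * ρ) / a) := by ring
    rw [this]; linarith [mul_nonneg hκ h4]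
  have hba1 : b ^ 2 / a ≤ a := by rw [div_le_iff₀ ha]; nlinarith
  have j5 : κ * (1 + c) * (b ^ 2 / a * h₂) ≤ κ * ((1 + c) * a) := by
    have : b ^ 2 / a * h₂ ≤ a * 1 := by gcongr
    calc _ ≤ κ * (1 + c) * (a * 1) := by gcongr
      _ = _ := by ring
  have j6 : (a * c + b - (1 + c) * (b ^ 2 / a)) * h₂ ≤ (2 * c + 1) * (a - b) := by
    have e : a * c + b - (1 + c) * (b ^ 2 / a) = (a - b) * (c * (a + b) + b) / a := by
      field_simp; ring
    have e' : a * c + b - (1 + c) * (b ^ 2 / a) ≤ (2 * c + 1) * (a - b) := by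
      rw [e, div_le_iff₀ ha]
      nlinarith [mul_nonneg (sub_nonneg.2 hba) (sub_nonneg.2 hba),
        mul_nonneg hc.le (mul_nonneg (sub_nonneg.2 hba) (sub_nonneg.2 hba))]
    have e0 : 0 ≤ (2 * c + 1) * (a - b) := mul_nonneg (by linarith) (by linarith)
    by_cases hs : 0 ≤ a * c + b - (1 + c) * (b ^ 2 / a)
    · exact (mul_le_of_le_one_right hs hh₂1).trans e'
    · exact (mul_nonpos_of_nonpos_of_nonneg (not_le.1 hs).le hh₂0).trans e0
  have j7 : 0 ≤ κ * (a * c * h₂) := by positivity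
  linarith
end LinearAlgebra

section Calculus

open Matrix

/-- The spatial gradient as a coordinate vector. -/
def gradVec (n : ℕ) (f : EuclideanSpace ℝ (Fin n) → ℝ) (x : EuclideanSpace ℝ (Fin n)) :
    Fin n → ℝ := fun i => pd n f i x

/-- The spatial Hessian as a matrix. -/
def hessMat (n : ℕ) (f : EuclideanSpace ℝ (Fin n) → ℝ) (x : EuclideanSpace ℝ (Fin n)) :
    Matrix (Fin n) (Fin n) ℝ := Matrix.of fun i j => pd2 n f i j x

variable {n : ℕ}

lemma gradVec_dotProduct_self (f : EuclideanSpace ℝ (Fin n) → ℝ) (x : EuclideanSpace ℝ (Fin n)) :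
    gradVec n f x ⬝ᵥ gradVec n f x = gradSq n f x := by
  simp [gradVec, gradSq, dotProduct, sq]

lemma invMetric_gradVec_apply (f : EuclideanSpace ℝ (Fin n) → ℝ) (x : EuclideanSpace ℝ (Fin n))
    (i j : Fin n) : invMetric (gradVec n f x) i j =
      (if i = j then (1 : ℝ) else 0) - pd n f i x * pd n f j x / (1 + gradSq n f x) := by
  simp [invMetric, gradVec_dotProduct_self, Matrix.one_apply, vecMulVec_apply, gradVec,
    div_eq_inv_mul]

lemma mcfRHS_eq_frob (f : EuclideanSpace ℝ (Fin n) → ℝ) (x : EuclideanSpace ℝ (Fin n)) :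
    mcfRHS n f x = frob (invMetric (gradVec n f x)) (hessMat n f x) := by
  simp [mcfRHS, frob, invMetric_gradVec_apply, hessMat]

lemma CurvCond.le_dotProduct {u : EuclideanSpace ℝ (Fin n) → ℝ → ℝ} {S : Set ℝ} {c : ℝ}
    (h : CurvCond n u S c) (x : EuclideanSpace ℝ (Fin n)) {t : ℝ} (ht : t ∈ S) (ξ : Fin n → ℝ) :
    -c * (ξ ⬝ᵥ ξ) ≤ ξ ⬝ᵥ
      (invMetric (gradVec n (fun y => u y t) x) * hessMat n (fun y => u y t) x) *ᵥ ξ := by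
  have h1 := h x t ht ξ
  have h2 : ξ ⬝ᵥ ξ = ∑ i, (ξ i) ^ 2 := by simp [dotProduct, sq]
  rw [h2]
  refine h1.le.trans (le_of_eq ?_)
  simp only [dotProduct, mulVec, Matrix.mul_apply, invMetric_gradVec_apply, hessMat,
    Matrix.of_apply, Finset.mul_sum]
  refine Finset.sum_congr rfl fun i _ => Finset.sum_congr rfl fun j _ => ?_
  rw [mul_assoc, mul_comm, mul_assoc, mul_comm, mul_assoc, mul_comm (ξ j), ← mul_assoc]
  ring

lemma fderiv_apply_eq_sum (f : EuclideanSpace ℝ (Fin n) → ℝ) (x v : EuclideanSpace ℝ (Fin n)) :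
    fderiv ℝ f x v = ∑ i, pd n f i x * v i := by
  conv_lhs => rw [← (EuclideanSpace.basisFun (Fin n) ℝ).sum_repr v]
  simp [pd, mul_comm]

lemma hasDerivAt_comp_line {f : EuclideanSpace ℝ (Fin n) → ℝ} (hf : Differentiable ℝ f)
    (x ξ : EuclideanSpace ℝ (Fin n)) (s : ℝ) :
    HasDerivAt (fun s : ℝ => f (x + s • ξ)) (gradVec n f (x + s • ξ) ⬝ᵥ ξ.ofLp) s := by
  have h1 : HasDerivAt (fun s : ℝ => x + s • ξ) ξ s := by
    simpa using ((hasDerivAt_id s).smul_const ξ).const_add x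
  have h2 := (hf (x + s • ξ)).hasFDerivAt.comp_hasDerivAt s h1
  rw [fderiv_apply_eq_sum] at h2
  exact h2

lemma contDiff_pd {f : EuclideanSpace ℝ (Fin n) → ℝ} (hf : ContDiff ℝ 2 f) (i : Fin n) :
    ContDiff ℝ 1 (pd n f i) :=
  (hf.fderiv_right (m := 1) (by norm_num)).clm_apply contDiff_const

lemma hessMat_isSymm {f : EuclideanSpace ℝ (Fin n) → ℝ} (hf : ContDiff ℝ 2 f)
    (x : EuclideanSpace ℝ (Fin n)) : (hessMat n f x).IsSymm := by
  ext i j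
  have hd : DifferentiableAt ℝ (fderiv ℝ f) x :=
    ((hf.fderiv_right (m := 1) (by norm_num)).differentiable (by norm_num)) x
  have key : ∀ i j, pd2 n f i j x =
      fderiv ℝ (fderiv ℝ f) x (EuclideanSpace.single i 1) (EuclideanSpace.single j 1) := by
    intro i j
    have : HasFDerivAt (fun y => fderiv ℝ f y (EuclideanSpace.single j (1 : ℝ)))
        ((fderiv ℝ (fderiv ℝ f) x).flip (EuclideanSpace.single j (1 : ℝ))) x := by
      simpa using hd.hasFDerivAt.clm_apply (hasFDerivAt_const (EuclideanSpace.single j (1 : ℝ)) x)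
    change fderiv ℝ (fun y => fderiv ℝ f y (EuclideanSpace.single j (1 : ℝ))) x _ = _
    rw [this.fderiv]
    simp
  have hs : IsSymmSndFDerivAt ℝ f x := hf.contDiffAt.isSymmSndFDerivAt (by simp)
  simp [hessMat, key, hs.eq]

lemma hasDerivAt_gradVec_line {f : EuclideanSpace ℝ (Fin n) → ℝ} (hf : ContDiff ℝ 2 f)
    (x ξ : EuclideanSpace ℝ (Fin n)) :
    HasDerivAt (fun s : ℝ => gradVec n f (x + s • ξ) ⬝ᵥ ξ.ofLp)
      (ξ.ofLp ⬝ᵥ hessMat n f x *ᵥ ξ.ofLp) 0 := by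
  have h : HasDerivAt (fun s : ℝ => ∑ i, pd n f i (x + s • ξ) * ξ i)
      (∑ i, (gradVec n (pd n f i) (x + (0 : ℝ) • ξ) ⬝ᵥ ξ.ofLp) * ξ i) 0 :=
    HasDerivAt.fun_sum fun i _ =>
      (hasDerivAt_comp_line ((contDiff_pd hf i).differentiable (by norm_num)) x ξ 0).mul_const _
  refine HasDerivAt.congr_deriv h ?_
  simp only [zero_smul, add_zero, dotProduct, mulVec, gradVec, Finset.mul_sum, Finset.sum_mul]
  rw [Finset.sum_comm]
  refine Finset.sum_congr rfl fun i _ => Finset.sum_congr rfl fun j _ => ?_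
  simp only [hessMat, Matrix.of_apply, pd2]
  ring

/-- First and second order necessary conditions at a local maximum. -/
lemma IsLocalMax.deriv_eq_zero_and_nonpos {φ φ' : ℝ → ℝ} {d s : ℝ} (hmax : IsLocalMax φ s)
    (h1 : ∀ r, HasDerivAt φ (φ' r) r) (h2 : HasDerivAt φ' d s) : φ' s = 0 ∧ d ≤ 0 := by
  have h0 : φ' s = 0 := hmax.hasDerivAt_eq_zero (h1 s)
  refine ⟨h0, not_lt.1 fun hd => ?_⟩
  have hder : deriv φ = φ' := funext fun r => (h1 r).deriv
  have hmin : IsLocalMin φ s := isLocalMin_of_deriv_deriv_pos (by rwa [hder, h2.deriv])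
    (by rw [hder, h0]) (h1 s).continuousAt
  have hconst : φ =ᶠ[nhds s] fun _ => φ s := by
    filter_upwards [hmax, hmin] with r hr1 hr2 using le_antisymm hr1 hr2
  have h3 : deriv (deriv φ) s = 0 := by
    rw [hconst.deriv.deriv_eq]
    simp
  rw [hder, h2.deriv] at h3
  exact hd.ne' h3

lemma deriv_nonneg_of_forall_le {φ : ℝ → ℝ} {d t₀ t : ℝ} (h : HasDerivAt φ d t) (ht : t₀ < t)
    (hle : ∀ s ∈ Set.Icc t₀ t, φ s ≤ φ t) : 0 ≤ d := by
  have hs := (hasDerivAt_iff_tendsto_slope_left_right.1 h).1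
  refine ge_of_tendsto hs ?_
  filter_upwards [Ioo_mem_nhdsLT ht] with s hs
  rw [slope_def_field]
  exact div_nonneg_of_nonpos (by linarith [hle s ⟨hs.1.le, hs.2.le⟩]) (by linarith [hs.2])

lemma norm_sq_eq_dotProduct (v : EuclideanSpace ℝ (Fin n)) : ‖v‖ ^ 2 = v.ofLp ⬝ᵥ v.ofLp := by
  rw [EuclideanSpace.norm_sq_eq]
  simp [dotProduct, sq]

lemma hasDerivAt_norm_sq_line (v w : EuclideanSpace ℝ (Fin n)) (s : ℝ) :
    HasDerivAt (fun s : ℝ => ‖v + s • w‖ ^ 2)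
      (2 * (v.ofLp ⬝ᵥ w.ofLp) + 2 * s * (w.ofLp ⬝ᵥ w.ofLp)) s := by
  have h : (fun s : ℝ => ‖v + s • w‖ ^ 2) = fun s : ℝ =>
      v.ofLp ⬝ᵥ v.ofLp + s * (2 * (v.ofLp ⬝ᵥ w.ofLp)) + s ^ 2 * (w.ofLp ⬝ᵥ w.ofLp) := by
    funext s
    simp only [norm_sq_eq_dotProduct, WithLp.ofLp_add, WithLp.ofLp_smul, add_dotProduct,
      dotProduct_add, smul_dotProduct, dotProduct_smul, smul_eq_mul,
      dotProduct_comm w.ofLp v.ofLp]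
    ring
  rw [h]
  have h1 := (((hasDerivAt_id s).mul_const (2 * (v.ofLp ⬝ᵥ w.ofLp))).const_add
    (v.ofLp ⬝ᵥ v.ofLp)).add (((hasDerivAt_id s).pow 2).mul_const (w.ofLp ⬝ᵥ w.ofLp))
  refine HasDerivAt.congr_deriv h1 ?_
  simp

/-- Optimality conditions for the penalised difference of `exp (-f)` and `exp (-g)`. -/
lemma doubling_optimality {f g : EuclideanSpace ℝ (Fin n) → ℝ} (hf : ContDiff ℝ 2 f)
    (hg : ContDiff ℝ 2 g) {β ε : ℝ} {x y : EuclideanSpace ℝ (Fin n)}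
    (hmax : ∀ x' y', exp (-f x') - exp (-g y') - β / 2 * ‖x' - y'‖ ^ 2 - ε * ‖x'‖ ^ 2 ≤
      exp (-f x) - exp (-g y) - β / 2 * ‖x - y‖ ^ 2 - ε * ‖x‖ ^ 2)
    (ξ η : EuclideanSpace ℝ (Fin n)) :
    -(exp (-f x) * (gradVec n f x ⬝ᵥ ξ.ofLp)) + exp (-g y) * (gradVec n g y ⬝ᵥ η.ofLp)
        - β * ((x - y).ofLp ⬝ᵥ (ξ - η).ofLp) - 2 * ε * (x.ofLp ⬝ᵥ ξ.ofLp) = 0 ∧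
    exp (-f x) * ((gradVec n f x ⬝ᵥ ξ.ofLp) ^ 2 - ξ.ofLp ⬝ᵥ hessMat n f x *ᵥ ξ.ofLp)
        - exp (-g y) * ((gradVec n g y ⬝ᵥ η.ofLp) ^ 2 - η.ofLp ⬝ᵥ hessMat n g y *ᵥ η.ofLp)
      ≤ β * ((ξ - η).ofLp ⬝ᵥ (ξ - η).ofLp) + 2 * ε * (ξ.ofLp ⬝ᵥ ξ.ofLp) := by
  have hf1 : Differentiable ℝ f := hf.differentiable (by norm_num)
  have hg1 : Differentiable ℝ g := hg.differentiable (by norm_num)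
  set φ : ℝ → ℝ := fun s => exp (-f (x + s • ξ)) - exp (-g (y + s • η))
    - β / 2 * ‖(x - y) + s • (ξ - η)‖ ^ 2 - ε * ‖x + s • ξ‖ ^ 2
  set φ' : ℝ → ℝ := fun s => exp (-f (x + s • ξ)) * -(gradVec n f (x + s • ξ) ⬝ᵥ ξ.ofLp)
    - exp (-g (y + s • η)) * -(gradVec n g (y + s • η) ⬝ᵥ η.ofLp)
    - β / 2 * (2 * ((x - y).ofLp ⬝ᵥ (ξ - η).ofLp) + 2 * s * ((ξ - η).ofLp ⬝ᵥ (ξ - η).ofLp))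
    - ε * (2 * (x.ofLp ⬝ᵥ ξ.ofLp) + 2 * s * (ξ.ofLp ⬝ᵥ ξ.ofLp))
  have h1 : ∀ r, HasDerivAt φ (φ' r) r := fun r =>
    ((((hasDerivAt_comp_line hf1 x ξ r).fun_neg.exp).fun_sub
      (hasDerivAt_comp_line hg1 y η r).fun_neg.exp).fun_sub
      ((hasDerivAt_norm_sq_line (x - y) (ξ - η) r).const_mul (β / 2))).fun_sub
      ((hasDerivAt_norm_sq_line x ξ r).const_mul ε)
  have hlin : ∀ p q : ℝ, HasDerivAt (fun s : ℝ => 2 * p + 2 * s * q) (2 * q) 0 := by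
    intro p q
    have := ((((hasDerivAt_id (0 : ℝ)).const_mul 2).mul_const q).const_add (2 * p))
    simpa using this
  have h2 := ((((hasDerivAt_comp_line hf1 x ξ 0).fun_neg.exp.fun_mul
      (hasDerivAt_gradVec_line hf x ξ).fun_neg).fun_sub
      ((hasDerivAt_comp_line hg1 y η 0).fun_neg.exp.fun_mul
      (hasDerivAt_gradVec_line hg y η).fun_neg)).fun_sub
      ((hlin ((x - y).ofLp ⬝ᵥ (ξ - η).ofLp) ((ξ - η).ofLp ⬝ᵥ (ξ - η).ofLp)).const_mul
        (β / 2))).fun_sub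
      ((hlin (x.ofLp ⬝ᵥ ξ.ofLp) (ξ.ofLp ⬝ᵥ ξ.ofLp)).const_mul ε)
  have hloc : IsLocalMax φ 0 := by
    refine Filter.Eventually.of_forall fun s => ?_
    have := hmax (x + s • ξ) (y + s • η)
    have hxy : x + s • ξ - (y + s • η) = (x - y) + s • (ξ - η) := by
      rw [smul_sub]; abel
    rw [hxy] at this
    simpa [φ] using this
  obtain ⟨h3, h4⟩ := hloc.deriv_eq_zero_and_nonpos h1 h2
  simp only [φ', zero_smul, add_zero, mul_zero, zero_mul] at h3 h4
  constructor <;> linarith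

end Calculus

section AlmostEverywhereGradientBound

open MeasureTheory

/-- **Rademacher's theorem** for locally Lipschitz functions. -/
lemma LocallyLipschitz.ae_differentiableAt_real {E : Type*} [NormedAddCommGroup E]
    [NormedSpace ℝ E] [FiniteDimensional ℝ E] [MeasurableSpace E] [BorelSpace E]
    {μ : Measure E} [μ.IsAddHaarMeasure] {g : E → ℝ} (hg : LocallyLipschitz g) :
    ∀ᵐ x ∂μ, DifferentiableAt ℝ g x := by
  have h : ∀ k : ℕ, ∀ᵐ x ∂μ, x ∈ Metric.closedBall (0 : E) k →
      DifferentiableWithinAt ℝ g (Metric.closedBall 0 k) x := by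
    intro k
    obtain ⟨K, hK⟩ := LocallyLipschitzOn.exists_lipschitzOnWith_of_compact
      (isCompact_closedBall (0 : E) k) hg.locallyLipschitzOn
    exact hK.ae_differentiableWithinAt_of_mem_of_real
  filter_upwards [ae_all_iff.2 h] with x hx
  obtain ⟨k, hk⟩ := exists_nat_gt ‖x‖
  have hx' : x ∈ Metric.ball (0 : E) k := by simpa using hk
  exact (hx k (Metric.ball_subset_closedBall hx')).differentiableAt
    (Filter.mem_of_superset (Metric.isOpen_ball.mem_nhds hx') Metric.ball_subset_closedBall)

/-- A locally Lipschitz function whose gradient is bounded by `L` almost everywhere is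
`L`-Lipschitz. -/
lemma LocallyLipschitz.abs_sub_le_of_ae_norm_fderiv_le {E : Type*} [NormedAddCommGroup E]
    [NormedSpace ℝ E] [FiniteDimensional ℝ E] [MeasurableSpace E] [BorelSpace E]
    (μ : Measure E) [μ.IsAddHaarMeasure] {g : E → ℝ} (hg : LocallyLipschitz g) {L : ℝ}
    (hL : ∀ᵐ x ∂μ, ‖fderiv ℝ g x‖ ≤ L) (x y : E) : |g y - g x| ≤ L * ‖y - x‖ := by
  set N : Set E := {x | ¬ (DifferentiableAt ℝ g x ∧ ‖fderiv ℝ g x‖ ≤ L)}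
  have hN : μ N = 0 := by
    have : ∀ᵐ x ∂μ, DifferentiableAt ℝ g x ∧ ‖fderiv ℝ g x‖ ≤ L := by
      filter_upwards [hg.ae_differentiableAt_real, hL] with x h1 h2 using ⟨h1, h2⟩
    exact this
  set N' := toMeasurable μ N
  have hN'm : MeasurableSet N' := measurableSet_toMeasurable μ N
  have hN' : ∀ᵐ z ∂μ, z ∉ N' := by
    rw [ae_iff]
    simpa [N', measure_toMeasurable] using hN
  have hgood : ∀ z, z ∉ N' → DifferentiableAt ℝ g z ∧ ‖fderiv ℝ g z‖ ≤ L := by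
    intro z hz
    by_contra h
    exact hz (subset_toMeasurable μ N h)
  set w := y - x
  have hline : ∀ᵐ z ∂μ, ∀ᵐ s : ℝ, z + s • w ∉ N' := by
    rw [Measure.ae_ae_comm (p := fun (z : E) (s : ℝ) => z + s • w ∉ N')]
    · refine Filter.Eventually.of_forall fun s => ?_
      exact (measurePreserving_add_right μ (s • w)).quasiMeasurePreserving.tendsto_ae.eventually hN'
    · have : Measurable fun p : E × ℝ => p.1 + p.2 • w :=
        (continuous_fst.add (continuous_snd.smul continuous_const)).measurable
      exact this hN'm.compl
  have hdense : Dense {z : E | |g (z + w) - g z| ≤ L * ‖w‖} := by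
    refine (Measure.dense_of_ae hline).mono fun z hz => ?_
    have hcomp : LocallyLipschitz (fun s : ℝ => g (z + s • w)) := by
      have h1 : ContDiff ℝ 1 (fun s : ℝ => z + s • w) := by fun_prop
      exact hg.comp h1.locallyLipschitz
    obtain ⟨K, hK⟩ := LocallyLipschitzOn.exists_lipschitzOnWith_of_compact
      (isCompact_uIcc (a := (0 : ℝ)) (b := 1)) hcomp.locallyLipschitzOn
    have hftc := hK.absolutelyContinuousOnInterval.integral_deriv_eq_sub
    have hbound : ∀ᵐ s : ℝ, s ∈ Set.uIoc (0 : ℝ) 1 →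
        ‖deriv (fun s : ℝ => g (z + s • w)) s‖ ≤ L * ‖w‖ := by
      filter_upwards [hz] with s hs _
      obtain ⟨hd, hb⟩ := hgood _ hs
      have h1 : HasDerivAt (fun s : ℝ => z + s • w) w s := by
        simpa using ((hasDerivAt_id s).smul_const w).const_add z
      have h2 := hd.hasFDerivAt.comp_hasDerivAt s h1
      have h3 : deriv (fun s : ℝ => g (z + s • w)) s = fderiv ℝ g (z + s • w) w := h2.deriv
      rw [h3]
      exact (ContinuousLinearMap.le_opNorm _ _).trans (by gcongr)
    have := intervalIntegral.norm_integral_le_of_norm_le_const_ae hbound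
    rw [hftc] at this
    simpa using this
  have hclosed : IsClosed {z : E | |g (z + w) - g z| ≤ L * ‖w‖} := by
    have := hg.continuous
    exact isClosed_le (by fun_prop) (by fun_prop)
  have := hclosed.closure_eq ▸ hdense x
  simpa [w] using this

end AlmostEverywhereGradientBound

/-- The operator norm of the differential is bounded by the Euclidean norm of the gradient. -/
lemma norm_fderiv_le_sqrt_gradSq (n : ℕ) (f : EuclideanSpace ℝ (Fin n) → ℝ)
    (x : EuclideanSpace ℝ (Fin n)) : ‖fderiv ℝ f x‖ ≤ √(gradSq n f x) := by
  refine ContinuousLinearMap.opNorm_le_bound _ (Real.sqrt_nonneg _) fun v => ?_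
  rw [fderiv_apply_eq_sum, Real.norm_eq_abs, gradSq, EuclideanSpace.norm_eq]
  simp only [Real.norm_eq_abs, sq_abs]
  rw [← Real.sqrt_mul (by positivity)]
  exact Real.abs_le_sqrt (Finset.sum_mul_sq_le_sq_mul_sq _ _ _)

/-- If the gradient of `u₀` is bounded on sublevel sets, `exp (-u₀)` is Lipschitz up to an
arbitrarily small error. -/
lemma exists_exp_neg_sub_le {n : ℕ} {u₀ : EuclideanSpace ℝ (Fin n) → ℝ}
    (hu₀ : LocallyLipschitz u₀) {B : ℝ} (hB : ∀ x, B ≤ u₀ x)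
    (hosc : ∀ M : ℝ, ∃ cM : ℝ, ∀ᵐ x ∂(MeasureTheory.volume),
      u₀ x < M → Real.sqrt (1 + gradSq n u₀ x) ≤ cM) {η : ℝ} (hη : 0 < η) :
    ∃ L : ℝ, 0 ≤ L ∧ ∀ x y, exp (-u₀ x) - exp (-u₀ y) ≤ η + L * ‖x - y‖ := by
  set M : ℝ := -Real.log η
  have hM : exp (-M) = η := by simp [M, Real.exp_log hη]
  obtain ⟨cM, hcM⟩ := hosc M
  set g : EuclideanSpace ℝ (Fin n) → ℝ := fun x => max (exp (-u₀ x)) η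
  have hexp : LocallyLipschitz fun x => exp (-u₀ x) := by
    have h1 : ContDiff ℝ 1 (fun s : ℝ => exp (-s)) := by fun_prop
    exact h1.locallyLipschitz.comp hu₀
  have hg : LocallyLipschitz g := hexp.max_const η
  set L := exp (-B) * |cM|
  have hL0 : 0 ≤ L := by positivity
  have hL : ∀ᵐ x ∂(MeasureTheory.volume : MeasureTheory.Measure (EuclideanSpace ℝ (Fin n))),
      ‖fderiv ℝ g x‖ ≤ L := by
    filter_upwards [hcM, hu₀.ae_differentiableAt_real] with x hx hd
    by_cases hxM : u₀ x < M
    · have hev : g =ᶠ[nhds x] fun y => exp (-u₀ y) := by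
        filter_upwards [hu₀.continuous.continuousAt.eventually_lt continuousAt_const hxM] with y hy
        have : η ≤ exp (-u₀ y) := by rw [← hM]; exact Real.exp_le_exp.2 (by linarith)
        simp [g, this]
      rw [hev.fderiv_eq]
      have h1 : HasFDerivAt (fun y => exp (-u₀ y)) (exp (-u₀ x) • (-fderiv ℝ u₀ x)) x :=
        hd.hasFDerivAt.neg.exp
      rw [h1.fderiv, norm_smul, norm_neg, Real.norm_eq_abs, abs_of_pos (Real.exp_pos _)]
      have h2 : ‖fderiv ℝ u₀ x‖ ≤ |cM| :=
        (norm_fderiv_le_sqrt_gradSq n u₀ x).trans <|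
          (Real.sqrt_le_sqrt (by linarith)).trans ((hx hxM).trans (le_abs_self _))
      have h3 : exp (-u₀ x) ≤ exp (-B) := Real.exp_le_exp.2 (by linarith [hB x])
      exact mul_le_mul h3 h2 (norm_nonneg _) (Real.exp_pos _).le
    · have hmin : IsLocalMin g x := by
        refine Filter.Eventually.of_forall fun y => ?_
        have : exp (-u₀ x) ≤ η := by rw [← hM]; exact Real.exp_le_exp.2 (by linarith)
        simp [g, this]
      simpa [hmin.fderiv_eq_zero] using hL0
  refine ⟨L, hL0, fun x y => ?_⟩
  have h := (abs_le.1 (hg.abs_sub_le_of_ae_norm_fderiv_le MeasureTheory.volume hL y x)).2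
  have h1 : exp (-u₀ x) ≤ g x := le_max_left _ _
  have h2 : g y ≤ exp (-u₀ y) + η :=
    max_le (by linarith) (by linarith [Real.exp_pos (-u₀ y)])
  linarith

section Comparison

open Matrix

variable {n : ℕ}

/-- At a maximum of the penalised difference of `exp (-f)` and `exp (-g)`, the difference of the
mean curvature operators is controlled by the difference of the values up to a small error. -/
lemma mcfRHS_le_of_isMax {f g : EuclideanSpace ℝ (Fin n) → ℝ} (hf : ContDiff ℝ 2 f)
    (hg : ContDiff ℝ 2 g) {c β ε δ Q ρ κ : ℝ} (hc : 0 < c) (hβ : 0 ≤ β) (hε : 0 ≤ ε)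
    {x y : EuclideanSpace ℝ (Fin n)}
    (hcurv : ∀ ξ : Fin n → ℝ, -c * (ξ ⬝ᵥ ξ) ≤
      ξ ⬝ᵥ (invMetric (gradVec n f x) * hessMat n f x) *ᵥ ξ)
    (hmax : ∀ x' y', exp (-f x') - exp (-g y') - β / 2 * ‖x' - y'‖ ^ 2 - ε * ‖x'‖ ^ 2 ≤
      exp (-f x) - exp (-g y) - β / 2 * ‖x - y‖ ^ 2 - ε * ‖x‖ ^ 2)
    (hδ : 0 < δ) (ha : δ ≤ exp (-f x)) (hba : exp (-g y) ≤ exp (-f x)) (hQ : 0 ≤ Q)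
    (hρ : 0 ≤ ρ) (hρ1 : ρ ≤ 1) (hQx : β * ‖x - y‖ ≤ Q) (hρx : 2 * ε * ‖x‖ ≤ ρ)
    (hκ : κ = 2 * ρ * (2 * Q + 1) / δ ^ 2 * (1 + Q ^ 2 / δ ^ 2)) (hκ1 : κ ≤ 1) :
    -exp (-f x) * mcfRHS n f x + exp (-g y) * mcfRHS n g y ≤
      (2 * c + 1) * (exp (-f x) - exp (-g y))
        + κ * (n * β + c * n * exp (-f x) + (1 + c) * exp (-f x)) + 2 * ε * n
        + 2 * (1 + c) * (Q * ρ) / exp (-f x) := by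
  have hopt := doubling_optimality hf hg hmax
  have hap : 0 < exp (-f x) := Real.exp_pos _
  have hbp : 0 < exp (-g y) := Real.exp_pos _
  set a := exp (-f x)
  set b := exp (-g y)
  set q : Fin n → ℝ := (-β) • (x - y).ofLp
  set r : Fin n → ℝ := (-(2 * ε)) • x.ofLp
  have hκ0 : 0 ≤ κ := by rw [hκ]; positivity
  have hq : q ⬝ᵥ q ≤ Q ^ 2 := by
    have : q ⬝ᵥ q = (β * ‖x - y‖) ^ 2 := by
      rw [mul_pow, norm_sq_eq_dotProduct]
      simp only [q, smul_dotProduct, dotProduct_smul, smul_eq_mul]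
      ring
    rw [this]
    gcongr
  have hr : r ⬝ᵥ r ≤ ρ ^ 2 := by
    have : r ⬝ᵥ r = (2 * ε * ‖x‖) ^ 2 := by
      rw [mul_pow, norm_sq_eq_dotProduct]
      simp only [r, smul_dotProduct, dotProduct_smul, smul_eq_mul]
      ring
    rw [this]
    gcongr
  have hp₁ : gradVec n f x = a⁻¹ • (q + r) := by
    funext i
    have h := (hopt (EuclideanSpace.single i 1) 0).1
    simp at h
    simp only [Pi.smul_apply, Pi.add_apply, smul_eq_mul, q, r, WithLp.ofLp_sub, Pi.sub_apply]
    field_simp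
    linarith
  have hp₂ : gradVec n g y = b⁻¹ • q := by
    funext i
    have h := (hopt 0 (EuclideanSpace.single i 1)).1
    simp at h
    simp only [Pi.smul_apply, smul_eq_mul, q, WithLp.ofLp_sub, Pi.sub_apply]
    field_simp
    linarith
  have hN := invMetric_sub_smul_posSemidef hδ ha hbp hba hQ hρ hρ1 hq hr hκ hκ1
  rw [← hp₁, ← hp₂] at hN
  rw [mcfRHS_eq_frob, mcfRHS_eq_frob]
  exact doubling_inequality hbp hba hc hβ hε hκ0 hκ1 hQ hρ hq hr hp₁ hp₂
    (fun ξ η => by simpa using (hopt (WithLp.toLp 2 ξ) (WithLp.toLp 2 η)).2)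
    (hessian_lower_bound hc _ _ (hessMat_isSymm hf x) hcurv) hN

lemma contDiff_slice {T : ℝ} {u : EuclideanSpace ℝ (Fin n) → ℝ → ℝ}
    (hu : ContDiffOn ℝ (⊤ : ℕ∞) (fun p : EuclideanSpace ℝ (Fin n) × ℝ => u p.1 p.2)
      (Set.univ ×ˢ Set.Ioc 0 T)) {t : ℝ} (ht : t ∈ Set.Ioc 0 T) :
    ContDiff ℝ 2 fun y => u y t := by
  rw [← contDiffOn_univ]
  have h1 : ContDiffOn ℝ 2 (fun p : EuclideanSpace ℝ (Fin n) × ℝ => u p.1 p.2)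
      (Set.univ ×ˢ Set.Ioc 0 T) := by
    exact_mod_cast contDiffOn_infty.1 hu 2
  have h2 : ContDiffOn ℝ 2 (fun y : EuclideanSpace ℝ (Fin n) => (y, t)) Set.univ := by fun_prop
  exact h1.comp h2 fun y _ => ⟨Set.mem_univ _, ht⟩

lemma IsMCFSolution.hasDerivAt {T : ℝ} {u : EuclideanSpace ℝ (Fin n) → ℝ → ℝ}
    (hflow : IsMCFSolution n u (Set.Ioc 0 T))
    (hu : ContDiffOn ℝ (⊤ : ℕ∞) (fun p : EuclideanSpace ℝ (Fin n) × ℝ => u p.1 p.2)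
      (Set.univ ×ˢ Set.Ioc 0 T)) (x : EuclideanSpace ℝ (Fin n)) {t : ℝ} (ht : t ∈ Set.Ioo 0 T) :
    HasDerivAt (fun s => u x s) (mcfRHS n (fun y => u y t) x) t := by
  have hmem : (Set.univ ×ˢ Set.Ioc 0 T : Set (EuclideanSpace ℝ (Fin n) × ℝ)) ∈ nhds (x, t) :=
    prod_mem_nhds Filter.univ_mem (Ioc_mem_nhds ht.1 ht.2)
  have h1 : DifferentiableAt ℝ (fun p : EuclideanSpace ℝ (Fin n) × ℝ => u p.1 p.2) (x, t) :=
    (hu.contDiffAt hmem).differentiableAt (by simp)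
  have h2 : DifferentiableAt ℝ (fun s : ℝ => (x, s)) t := by fun_prop
  have h3 : DifferentiableAt ℝ (fun s => u x s) t := h1.comp t h2
  rw [← hflow x t ⟨ht.1, ht.2.le⟩]
  exact h3.hasDerivAt

/-- A solution satisfying the curvature condition decreases at most linearly in time. -/
lemma IsMCFSolution.sub_le {T c : ℝ} {u₀ : EuclideanSpace ℝ (Fin n) → ℝ}
    {u : EuclideanSpace ℝ (Fin n) → ℝ → ℝ} (hflow : IsMCFSolution n u (Set.Ioc 0 T))
    (hu : ContDiffOn ℝ (⊤ : ℕ∞) (fun p : EuclideanSpace ℝ (Fin n) × ℝ => u p.1 p.2)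
      (Set.univ ×ˢ Set.Ioc 0 T)) (hcurv : CurvCond n u (Set.Ioc 0 T) c)
    (hinit : TendstoLocallyUniformly (fun t x => u x t) u₀ (nhdsWithin 0 (Set.Ioi 0)))
    (x : EuclideanSpace ℝ (Fin n)) {t : ℝ} (ht : t ∈ Set.Ioo 0 T) :
    u₀ x - c * n * t ≤ u x t := by
  have hder : ∀ s ∈ Set.Ioo 0 T, HasDerivAt (fun s => u x s + c * n * s)
      (mcfRHS n (fun y => u y s) x + c * n) s := by
    intro s hs
    have := (hflow.hasDerivAt hu x hs).fun_add ((hasDerivAt_id s).const_mul (c * n))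
    simpa using this
  have hmono : MonotoneOn (fun s => u x s + c * n * s) (Set.Ioo 0 T) := by
    refine monotoneOn_of_deriv_nonneg (convex_Ioo 0 T)
      (fun s hs => (hder s hs).continuousAt.continuousWithinAt) ?_ ?_
    · rw [interior_Ioo]
      exact fun s hs => (hder s hs).differentiableAt.differentiableWithinAt
    · rw [interior_Ioo]
      intro s hs
      have hs' : s ∈ Set.Ioc 0 T := ⟨hs.1, hs.2.le⟩
      rw [(hder s hs).deriv, mcfRHS_eq_frob]
      have := frob_invMetric_lower_bound _ _ (hessMat_isSymm (contDiff_slice hu hs') x)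
        (hcurv.le_dotProduct x hs')
      linarith
  have hlim : Filter.Tendsto (fun s => u x s + c * n * s) (nhdsWithin 0 (Set.Ioi 0))
      (nhds (u₀ x + c * n * 0)) := by
    have h1 := (tendstoLocallyUniformlyOn_univ.2 hinit).tendsto_at (Set.mem_univ x)
    refine h1.add (Filter.Tendsto.const_mul _ ?_)
    exact Filter.tendsto_id.mono_left nhdsWithin_le_nhds
  have := le_of_tendsto hlim (b := u x t + c * n * t) (by
    filter_upwards [Ioo_mem_nhdsGT ht.1] with s hs
    exact hmono ⟨hs.1, hs.2.trans ht.2⟩ ht hs.2.le)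
  linarith

end Comparison

section Choices

variable {n : ℕ}

/-- Choice of the localisation parameter: all error terms vanish as `ε → 0⁺`. -/
lemma exists_small_parameter (n : ℕ) {c F m E Q β X : ℝ} (hm : 0 < m) :
    ∃ ε : ℝ, 0 < ε ∧ ε * X ≤ m ∧ 2 * E * √(ε * F) ≤ 1 ∧
      2 * (2 * E * √(ε * F)) * (2 * Q + 1) / m ^ 2 * (1 + Q ^ 2 / m ^ 2) ≤ 1 ∧
      2 * (2 * E * √(ε * F)) * (2 * Q + 1) / m ^ 2 * (1 + Q ^ 2 / m ^ 2)
          * (n * β + c * n * F + (1 + c) * F) + 2 * (ε * E) * n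
        + 2 * (1 + c) * (Q * (2 * E * √(ε * F))) / m < m := by
  have key : ∀ φ : ℝ → ℝ, Continuous φ → φ 0 = 0 → ∀ b : ℝ, 0 < b →
      ∀ᶠ ε in nhdsWithin (0 : ℝ) (Set.Ioi 0), φ ε < b := by
    intro φ hφ h0 b hb
    exact (hφ.continuousAt.eventually_lt continuousAt_const (by rwa [h0])).filter_mono
      nhdsWithin_le_nhds
  have h1 := key (fun ε => ε * X) (by fun_prop) (by simp) m hm
  have h2 := key (fun ε => 2 * E * √(ε * F)) (by fun_prop) (by simp) 1 one_pos
  have h3 := key (fun ε => 2 * (2 * E * √(ε * F)) * (2 * Q + 1) / m ^ 2 * (1 + Q ^ 2 / m ^ 2))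
    (by fun_prop) (by simp) 1 one_pos
  have h4 := key (fun ε => 2 * (2 * E * √(ε * F)) * (2 * Q + 1) / m ^ 2 * (1 + Q ^ 2 / m ^ 2)
          * (n * β + c * n * F + (1 + c) * F) + 2 * (ε * E) * n
        + 2 * (1 + c) * (Q * (2 * E * √(ε * F))) / m) (by fun_prop) (by simp) m hm
  obtain ⟨ε, h1, h2, h3, h4, h5⟩ :=
    (h1.and (h2.and (h3.and (h4.and self_mem_nhdsWithin)))).exists
  exact ⟨ε, h5, h1.le, h2.le, h3.le, h4⟩

/-- Local uniform convergence of the initial data, in terms of `exp (-u)`. -/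
lemma exists_time_abs_exp_sub_lt {u₀ : EuclideanSpace ℝ (Fin n) → ℝ}
    {u : EuclideanSpace ℝ (Fin n) → ℝ → ℝ} {B : ℝ} (hB : ∀ x, B ≤ u₀ x)
    (hinit : TendstoLocallyUniformly (fun t x => u x t) u₀ (nhdsWithin 0 (Set.Ioi 0)))
    (R : ℝ) {η : ℝ} (hη : 0 < η) :
    ∀ᶠ t in nhdsWithin (0 : ℝ) (Set.Ioi 0), ∀ x ∈ Metric.closedBall (0 : EuclideanSpace ℝ (Fin n)) R,
      |exp (-u x t) - exp (-u₀ x)| ≤ η := by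
  have hF : 0 < exp (-B) := Real.exp_pos _
  set δ := Real.log (1 + η / exp (-B))
  have hpos : 1 < 1 + η / exp (-B) := by linarith [div_pos hη hF]
  have hδ : 0 < δ := Real.log_pos hpos
  have hexp : exp δ = 1 + η / exp (-B) := Real.exp_log (by linarith)
  have hunif := (tendstoLocallyUniformlyOn_iff_tendstoUniformlyOn_of_compact
    (isCompact_closedBall (0 : EuclideanSpace ℝ (Fin n)) R)).1
    hinit.tendstoLocallyUniformlyOn
  filter_upwards [Metric.tendstoUniformlyOn_iff.1 hunif δ hδ] with t ht x hx
  have h := ht x hx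
  rw [Real.dist_eq, abs_lt] at h
  have h0 : exp (-u₀ x) ≤ exp (-B) := Real.exp_le_exp.2 (by linarith [hB x])
  have h0' : 0 < exp (-u₀ x) := Real.exp_pos _
  have hup : exp (-u x t) ≤ exp (-u₀ x) * exp δ := by
    rw [← Real.exp_add]; exact Real.exp_le_exp.2 (by linarith [h.2])
  have hlow : exp (-u₀ x) * exp (-δ) ≤ exp (-u x t) := by
    rw [← Real.exp_add]; exact Real.exp_le_exp.2 (by linarith [h.1])
  have h1 : exp (-u₀ x) * (exp δ - 1) ≤ η := by
    calc exp (-u₀ x) * (exp δ - 1) ≤ exp (-B) * (exp δ - 1) := by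
          gcongr
          linarith [div_pos hη hF]
      _ = η := by rw [hexp]; field_simp; ring
  have h2 : 2 - exp δ ≤ exp (-δ) := by
    linarith [Real.add_one_le_exp δ, Real.add_one_le_exp (-δ)]
  have h3 : exp (-u₀ x) * (2 - exp δ) ≤ exp (-u₀ x) * exp (-δ) := by gcongr
  rw [abs_le]
  constructor <;> linarith

lemma continuousOn_exp_neg {T : ℝ} {u : EuclideanSpace ℝ (Fin n) → ℝ → ℝ}
    (hu : ContDiffOn ℝ (⊤ : ℕ∞) (fun p : EuclideanSpace ℝ (Fin n) × ℝ => u p.1 p.2)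
      (Set.univ ×ˢ Set.Ioc 0 T)) {X : Type*} [TopologicalSpace X] {s : Set X}
    {φ : X → EuclideanSpace ℝ (Fin n)} {τ : X → ℝ} (hφ : ContinuousOn φ s) (hτ : ContinuousOn τ s)
    (hs : ∀ z ∈ s, τ z ∈ Set.Ioc 0 T) :
    ContinuousOn (fun z => exp (-u (φ z) (τ z))) s := by
  have h := hu.continuousOn.comp (hφ.prodMk hτ) fun z hz => ⟨Set.mem_univ _, hs z hz⟩
  exact h.neg.rexp

end Choices

section Uniqueness

variable {n : ℕ}

set_option maxHeartbeats 1000000 in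
/-- One-sided comparison: only the larger of the two candidates needs the curvature condition. -/
theorem exp_neg_le_exp_neg {T c B : ℝ} (hc : 0 < c) {u₀ : EuclideanSpace ℝ (Fin n) → ℝ}
    (hu₀ : LocallyLipschitz u₀) (hB : ∀ x, B ≤ u₀ x)
    (hosc : ∀ M : ℝ, ∃ cM : ℝ, ∀ᵐ x ∂(MeasureTheory.volume),
      u₀ x < M → Real.sqrt (1 + gradSq n u₀ x) ≤ cM)
    {u₁ u₂ : EuclideanSpace ℝ (Fin n) → ℝ → ℝ}
    (hsmooth₁ : ContDiffOn ℝ (⊤ : ℕ∞) (fun p : EuclideanSpace ℝ (Fin n) × ℝ => u₁ p.1 p.2)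
      (Set.univ ×ˢ Set.Ioc 0 T))
    (hsmooth₂ : ContDiffOn ℝ (⊤ : ℕ∞) (fun p : EuclideanSpace ℝ (Fin n) × ℝ => u₂ p.1 p.2)
      (Set.univ ×ˢ Set.Ioc 0 T))
    (hflow₁ : IsMCFSolution n u₁ (Set.Ioc 0 T))
    (hflow₂ : IsMCFSolution n u₂ (Set.Ioc 0 T))
    (hcurv₁ : CurvCond n u₁ (Set.Ioc 0 T) c)
    (hinit₁ : TendstoLocallyUniformly (fun t x => u₁ x t) u₀ (nhdsWithin 0 (Set.Ioi 0)))
    (hinit₂ : TendstoLocallyUniformly (fun t x => u₂ x t) u₀ (nhdsWithin 0 (Set.Ioi 0)))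
    (x₀ : EuclideanSpace ℝ (Fin n)) {t₁ : ℝ} (ht₁ : t₁ ∈ Set.Ioo 0 T) :
    exp (-u₁ x₀ t₁) ≤ exp (-u₂ x₀ t₁) := by
  by_contra! hlt
  set K : ℝ := 2 * c + 2 with hK
  have hK0 : 0 < K := by positivity
  obtain ⟨m, hm⟩ : ∃ m, m = exp (-K * t₁) * (exp (-u₁ x₀ t₁) - exp (-u₂ x₀ t₁)) / 2 := ⟨_, rfl⟩
  have hm0 : 0 < m := by
    have := sub_pos.2 hlt
    rw [hm]; positivity
  obtain ⟨F, hFdef⟩ : ∃ F, F = exp (-(B - c * n * T)) := ⟨_, rfl⟩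
  have hF0 : 0 < F := by rw [hFdef]; positivity
  have hF : ∀ x, ∀ t ∈ Set.Ioo 0 T, exp (-u₁ x t) ≤ F := by
    intro x t ht
    rw [hFdef]
    have h1 := hflow₁.sub_le hsmooth₁ hcurv₁ hinit₁ x ht
    have h2 : c * n * t ≤ c * n * T := by
      have := ht.2.le
      gcongr
    exact Real.exp_le_exp.2 (by linarith [hB x])
  obtain ⟨E, hE⟩ : ∃ E, E = exp (K * t₁) := ⟨_, rfl⟩
  have hE0 : 0 < E := by rw [hE]; positivity
  obtain ⟨L, hL0, hL⟩ := exists_exp_neg_sub_le hu₀ hB hosc (η := m / 8) (by positivity)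
  obtain ⟨α, hα⟩ : ∃ α, α = m / (L ^ 2 + 1) := ⟨_, rfl⟩
  have hα0 : 0 < α := by rw [hα]; positivity
  have hLα : L ^ 2 * α ≤ m := by
    rw [hα, mul_div_assoc', div_le_iff₀ (by positivity)]
    nlinarith
  set D := √(2 * α * F) with hD
  have hD0 : 0 ≤ D := Real.sqrt_nonneg _
  obtain ⟨Q, hQ⟩ : ∃ Q, Q = E / α * D := ⟨_, rfl⟩
  have hQ0 : 0 ≤ Q := by rw [hQ]; positivity
  obtain ⟨ε, hε0, hεx, hρ1, hκ1, herr⟩ :=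
    exists_small_parameter n (c := c) (F := F) (E := E) (Q := Q) (β := E / α) (X := ‖x₀‖ ^ 2) hm0
  obtain ⟨ρ, hρ⟩ : ∃ ρ, ρ = 2 * E * √(ε * F) := ⟨_, rfl⟩
  rw [← hρ] at hρ1 hκ1 herr
  have hρ0 : 0 ≤ ρ := by rw [hρ]; positivity
  obtain ⟨κ, hκ⟩ : ∃ κ, κ = 2 * ρ * (2 * Q + 1) / m ^ 2 * (1 + Q ^ 2 / m ^ 2) := ⟨_, rfl⟩
  rw [← hκ] at hκ1 herr
  have hκ0 : 0 ≤ κ := by rw [hκ]; positivity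
  set R := √(F / ε) + D
  obtain ⟨t₀, h₁, h₂, ht₀⟩ :=
    ((exists_time_abs_exp_sub_lt hB hinit₁ R (η := m / 8) (by positivity)).and
    ((exists_time_abs_exp_sub_lt hB hinit₂ R (η := m / 8) (by positivity)).and
      (Ioo_mem_nhdsGT ht₁.1))).exists
  have hIoo : ∀ t ∈ Set.Icc t₀ t₁, t ∈ Set.Ioo 0 T := fun t ht =>
    ⟨ht₀.1.trans_le ht.1, ht.2.trans_lt ht₁.2⟩
  set Φ : EuclideanSpace ℝ (Fin n) → EuclideanSpace ℝ (Fin n) → ℝ → ℝ := fun x y t =>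
    exp (-K * t) * (exp (-u₁ x t) - exp (-u₂ y t)) - ‖x - y‖ ^ 2 / (2 * α) - ε * ‖x‖ ^ 2 with hΦ
  have hexpK : ∀ t ∈ Set.Icc t₀ t₁, exp (-K * t) ≤ 1 := fun t ht => by
    rw [Real.exp_le_one_iff]
    nlinarith [(hIoo t ht).1]
  have hloc : ∀ x y, ∀ t ∈ Set.Icc t₀ t₁, 0 ≤ Φ x y t →
      ε * ‖x‖ ^ 2 ≤ F ∧ ‖x - y‖ ^ 2 ≤ 2 * α * F := by
    intro x y t ht hpos
    have h3 : exp (-K * t) * (exp (-u₁ x t) - exp (-u₂ y t)) ≤ F := by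
      calc exp (-K * t) * (exp (-u₁ x t) - exp (-u₂ y t)) ≤ exp (-K * t) * F := by
            gcongr
            linarith [hF x t (hIoo t ht), Real.exp_pos (-u₂ y t)]
        _ ≤ 1 * F := by
            gcongr
            exact hexpK t ht
        _ = F := one_mul F
    have h4 : 0 ≤ ‖x - y‖ ^ 2 / (2 * α) := by positivity
    have h5 : 0 ≤ ε * ‖x‖ ^ 2 := by positivity
    simp only [hΦ] at hpos
    refine ⟨by linarith, ?_⟩
    have h6 : ‖x - y‖ ^ 2 / (2 * α) ≤ F := by linarith
    rw [div_le_iff₀ (by positivity)] at h6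
    linarith
  have hball : ∀ x y, ∀ t ∈ Set.Icc t₀ t₁, 0 ≤ Φ x y t →
      x ∈ Metric.closedBall (0 : EuclideanSpace ℝ (Fin n)) R ∧
      y ∈ Metric.closedBall (0 : EuclideanSpace ℝ (Fin n)) R := by
    intro x y t ht hpos
    obtain ⟨h3, h4⟩ := hloc x y t ht hpos
    have h5 : ‖x‖ ≤ √(F / ε) := Real.le_sqrt_of_sq_le (by
      rw [le_div_iff₀ hε0]; linarith)
    have h6 : ‖x - y‖ ≤ D := Real.le_sqrt_of_sq_le h4
    have h7 : ‖y‖ ≤ ‖x‖ + ‖x - y‖ := by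
      calc ‖y‖ = ‖x - (x - y)‖ := by simp
        _ ≤ _ := norm_sub_le _ _
    simp only [mem_closedBall_zero_iff]
    exact ⟨by linarith, by linarith⟩
  have hstart : m ≤ Φ x₀ x₀ t₁ := by
    simp only [hΦ, sub_self, norm_zero]
    have : exp (-K * t₁) * (exp (-u₁ x₀ t₁) - exp (-u₂ x₀ t₁)) = 2 * m := by rw [hm]; ring
    rw [this]
    norm_num
    linarith
  have ht₁mem : t₁ ∈ Set.Icc t₀ t₁ := ⟨ht₀.2.le, le_rfl⟩
  have hinitial : ∀ x ∈ Metric.closedBall (0 : EuclideanSpace ℝ (Fin n)) R,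
      ∀ y ∈ Metric.closedBall (0 : EuclideanSpace ℝ (Fin n)) R, Φ x y t₀ < m := by
    intro x hx y hy
    have h3 := (abs_le.1 (h₁ x hx)).2
    have h4 := (abs_le.1 (h₂ y hy)).1
    have h5 := hL x y
    have h6 : exp (-u₁ x t₀) - exp (-u₂ y t₀) ≤ 3 * m / 8 + L * ‖x - y‖ := by linarith
    have h7 : exp (-K * t₀) * (exp (-u₁ x t₀) - exp (-u₂ y t₀)) ≤ 3 * m / 8 + L * ‖x - y‖ := by
      calc exp (-K * t₀) * (exp (-u₁ x t₀) - exp (-u₂ y t₀))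
          ≤ exp (-K * t₀) * (3 * m / 8 + L * ‖x - y‖) := by gcongr
        _ ≤ 1 * (3 * m / 8 + L * ‖x - y‖) := by
            gcongr
            exact hexpK t₀ ⟨le_rfl, ht₀.2.le⟩
        _ = _ := one_mul _
    have h8 : L * ‖x - y‖ ≤ L ^ 2 * α / 2 + ‖x - y‖ ^ 2 / (2 * α) := by
      have : L ^ 2 * α / 2 + ‖x - y‖ ^ 2 / (2 * α) - L * ‖x - y‖
          = (L * α - ‖x - y‖) ^ 2 / (2 * α) := by field_simp; ring
      have : 0 ≤ (L * α - ‖x - y‖) ^ 2 / (2 * α) := by positivity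
      linarith
    have h9 : 0 ≤ ε * ‖x‖ ^ 2 := by positivity
    simp only [hΦ]
    linarith
  obtain ⟨⟨x, y, t⟩, ⟨hx, hy, ht⟩, hmaxS⟩ :=
    ((isCompact_closedBall (0 : EuclideanSpace ℝ (Fin n)) R).prod
      ((isCompact_closedBall (0 : EuclideanSpace ℝ (Fin n)) R).prod
        (isCompact_Icc (a := t₀) (b := t₁)))).exists_isMaxOn
      (f := fun z => Φ z.1 z.2.1 z.2.2)
      ⟨(x₀, x₀, t₁), (hball x₀ x₀ t₁ ht₁mem (hm0.le.trans hstart)).1,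
        (hball x₀ x₀ t₁ ht₁mem (hm0.le.trans hstart)).1, ht₁mem⟩ (by
      have c1 := continuousOn_exp_neg hsmooth₁
        (s := Metric.closedBall (0 : EuclideanSpace ℝ (Fin n)) R ×ˢ
          Metric.closedBall (0 : EuclideanSpace ℝ (Fin n)) R ×ˢ Set.Icc t₀ t₁)
        (φ := fun z => z.1) (τ := fun z => z.2.2) (by fun_prop) (by fun_prop)
        fun z hz => ⟨(hIoo _ hz.2.2).1, (hIoo _ hz.2.2).2.le⟩
      have c2 := continuousOn_exp_neg hsmooth₂
        (s := Metric.closedBall (0 : EuclideanSpace ℝ (Fin n)) R ×ˢ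
          Metric.closedBall (0 : EuclideanSpace ℝ (Fin n)) R ×ˢ Set.Icc t₀ t₁)
        (φ := fun z => z.2.1) (τ := fun z => z.2.2) (by fun_prop) (by fun_prop)
        fun z hz => ⟨(hIoo _ hz.2.2).1, (hIoo _ hz.2.2).2.le⟩
      exact (((by fun_prop : Continuous fun z : EuclideanSpace ℝ (Fin n) ×
        EuclideanSpace ℝ (Fin n) × ℝ => exp (-K * z.2.2)).continuousOn.mul (c1.sub c2)).sub
        (by fun_prop)).sub (by fun_prop))
  have hge : m ≤ Φ x y t := by
    refine hstart.trans (hmaxS (a := (x₀, x₀, t₁)) ?_)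
    exact ⟨(hball x₀ x₀ t₁ ht₁mem (hm0.le.trans hstart)).1,
        (hball x₀ x₀ t₁ ht₁mem (hm0.le.trans hstart)).1, ht₁mem⟩
  have hmax : ∀ x' y', ∀ s ∈ Set.Icc t₀ t₁, Φ x' y' s ≤ Φ x y t := by
    intro x' y' s hs
    by_cases hpos : 0 ≤ Φ x' y' s
    · obtain ⟨h3, h4⟩ := hball x' y' s hs hpos
      exact hmaxS (a := (x', y', s)) ⟨h3, h4, hs⟩
    · linarith
  have htlt : t₀ < t := by
    refine lt_of_le_of_ne ht.1 fun h => ?_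
    have := hinitial x hx y hy
    rw [h] at this
    linarith
  have htT := hIoo t ht
  have htT' : t ∈ Set.Ioc 0 T := ⟨htT.1, htT.2.le⟩
  obtain ⟨hεF, hxyF⟩ := hloc x y t ht (hm0.le.trans hge)
  have hxyD : ‖x - y‖ ≤ D := Real.le_sqrt_of_sq_le hxyF
  have hexpt : exp (K * t) ≤ E := by
    rw [hE]
    have := ht.2
    exact Real.exp_le_exp.2 (by gcongr)
  have hexpinv : exp (K * t) * exp (-K * t) = 1 := by
    rw [← Real.exp_add]; simp
  have hexpp : 0 < exp (K * t) := Real.exp_pos _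
  have hab : m ≤ exp (-u₁ x t) - exp (-u₂ y t) := by
    have h3 : 0 ≤ ‖x - y‖ ^ 2 / (2 * α) := by positivity
    have h4 : 0 ≤ ε * ‖x‖ ^ 2 := by positivity
    have h5 : m ≤ exp (-K * t) * (exp (-u₁ x t) - exp (-u₂ y t)) := by
      simp only [hΦ] at hge; linarith
    have h6 : 0 < exp (-u₁ x t) - exp (-u₂ y t) := by
      by_contra! h
      have := mul_nonpos_of_nonneg_of_nonpos (Real.exp_pos (-K * t)).le h
      linarith
    exact h5.trans (mul_le_of_le_one_left h6.le (hexpK t ht))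
  have hspace := mcfRHS_le_of_isMax (contDiff_slice hsmooth₁ htT') (contDiff_slice hsmooth₂ htT')
    (β := exp (K * t) / α) (ε := ε * exp (K * t)) (x := x) (y := y) (δ := m) (Q := Q) (ρ := ρ)
    (κ := κ) hc (by positivity) (by positivity) (hcurv₁.le_dotProduct x htT') (by
      intro x' y'
      have h3 := mul_le_mul_of_nonneg_left (hmax x' y' t ht) hexpp.le
      have h4 : ∀ a b : EuclideanSpace ℝ (Fin n), exp (K * t) * Φ a b t =
          exp (-u₁ a t) - exp (-u₂ b t) - exp (K * t) / α / 2 * ‖a - b‖ ^ 2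
            - ε * exp (K * t) * ‖a‖ ^ 2 := by
        intro a b
        simp only [hΦ]
        rw [mul_sub, mul_sub, ← mul_assoc, hexpinv]
        field_simp
      rwa [h4, h4] at h3)
    hm0 (by linarith [Real.exp_pos (-u₂ y t)]) (by linarith) hQ0 hρ0 hρ1
    (by rw [hQ]; gcongr)
    (by
      have h3 : ε * ‖x‖ ≤ √(ε * F) := Real.le_sqrt_of_sq_le (by
        calc (ε * ‖x‖) ^ 2 = ε * (ε * ‖x‖ ^ 2) := by ring
          _ ≤ ε * F := by gcongr)
      calc 2 * (ε * exp (K * t)) * ‖x‖ = 2 * exp (K * t) * (ε * ‖x‖) := by ring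
        _ ≤ 2 * E * √(ε * F) := by gcongr
        _ = ρ := hρ.symm)
    hκ hκ1
  have htime : 0 ≤ exp (-K * t) * -K * (exp (-u₁ x t) - exp (-u₂ y t)) + exp (-K * t) *
      (exp (-u₁ x t) * -mcfRHS n (fun z => u₁ z t) x
        - exp (-u₂ y t) * -mcfRHS n (fun z => u₂ z t) y) := by
    have d0 : HasDerivAt (fun s : ℝ => exp (-K * s)) (exp (-K * t) * -K) t := by
      simpa using ((hasDerivAt_id t).const_mul (-K)).exp
    have d1 := (hflow₁.hasDerivAt hsmooth₁ x htT).fun_neg.exp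
    have d2 := (hflow₂.hasDerivAt hsmooth₂ y htT).fun_neg.exp
    have d3 := ((d0.fun_mul (d1.fun_sub d2)).sub_const (‖x - y‖ ^ 2 / (2 * α))).sub_const
      (ε * ‖x‖ ^ 2)
    exact deriv_nonneg_of_forall_le d3 htlt fun s hs => hmax x y s ⟨hs.1, hs.2.trans ht.2⟩
  have htime' : K * (exp (-u₁ x t) - exp (-u₂ y t)) ≤
      -exp (-u₁ x t) * mcfRHS n (fun z => u₁ z t) x
        + exp (-u₂ y t) * mcfRHS n (fun z => u₂ z t) y := by
    have h3 := mul_nonneg hexpp.le htime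
    have h4 : exp (K * t) * (exp (-K * t) * -K * (exp (-u₁ x t) - exp (-u₂ y t)) + exp (-K * t) *
      (exp (-u₁ x t) * -mcfRHS n (fun z => u₁ z t) x
        - exp (-u₂ y t) * -mcfRHS n (fun z => u₂ z t) y)) = (exp (K * t) * exp (-K * t)) *
        (-K * (exp (-u₁ x t) - exp (-u₂ y t)) + (exp (-u₁ x t) * -mcfRHS n (fun z => u₁ z t) x
        - exp (-u₂ y t) * -mcfRHS n (fun z => u₂ z t) y)) := by ring
    rw [h4, hexpinv] at h3
    linarith
  have hma : m ≤ exp (-u₁ x t) := by linarith [Real.exp_pos (-u₂ y t)]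
  have haF := hF x t htT
  have e1 : κ * (n * (exp (K * t) / α) + c * n * exp (-u₁ x t) + (1 + c) * exp (-u₁ x t))
      ≤ κ * (n * (E / α) + c * n * F + (1 + c) * F) := by gcongr
  have e2 : 2 * (ε * exp (K * t)) * n ≤ 2 * (ε * E) * n := by gcongr
  have e3 : 2 * (1 + c) * (Q * ρ) / exp (-u₁ x t) ≤ 2 * (1 + c) * (Q * ρ) / m := by gcongr
  rw [hK] at htime'
  linarith

end Uniqueness

/-- **Theorem 4.5 (uniqueness for entire graphs, not necessarily proper).**
If `u₀` is locally Lipschitz, bounded below, and its gradient function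
`√(1+|Du₀|²)` is bounded (a.e.) on every sublevel set `{u₀ < M}`, then two
smooth entire-graph MCF solutions satisfying the curvature lower bound
`v hⁱⱼ ≥ −c δⁱⱼ` with the same constant `c > 0` and the same initial data `u₀`
coincide. -/
theorem mcf_uniqueness_nonproper (n : ℕ) (T : ℝ) (hT : 0 < T)
    (u₀ : EuclideanSpace ℝ (Fin n) → ℝ)
    (hu₀ : LocallyLipschitz u₀)
    (hbdd : ∃ B : ℝ, ∀ x, B ≤ u₀ x)
    (hosc : ∀ M : ℝ, ∃ cM : ℝ, ∀ᵐ x ∂(MeasureTheory.volume),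
      u₀ x < M → Real.sqrt (1 + gradSq n u₀ x) ≤ cM)
    (u₁ u₂ : EuclideanSpace ℝ (Fin n) → ℝ → ℝ)
    (hsmooth₁ : ContDiffOn ℝ (⊤ : ℕ∞) (fun p : EuclideanSpace ℝ (Fin n) × ℝ => u₁ p.1 p.2)
      (Set.univ ×ˢ Set.Ioc 0 T))
    (hsmooth₂ : ContDiffOn ℝ (⊤ : ℕ∞) (fun p : EuclideanSpace ℝ (Fin n) × ℝ => u₂ p.1 p.2)
      (Set.univ ×ˢ Set.Ioc 0 T))
    (hflow₁ : IsMCFSolution n u₁ (Set.Ioc 0 T))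
    (hflow₂ : IsMCFSolution n u₂ (Set.Ioc 0 T))
    (c : ℝ) (hc : 0 < c)
    (hcurv₁ : CurvCond n u₁ (Set.Ioc 0 T) c)
    (hcurv₂ : CurvCond n u₂ (Set.Ioc 0 T) c)
    (hinit₁ : TendstoLocallyUniformly (fun t x => u₁ x t) u₀ (nhdsWithin 0 (Set.Ioi 0)))
    (hinit₂ : TendstoLocallyUniformly (fun t x => u₂ x t) u₀ (nhdsWithin 0 (Set.Ioi 0))) :
    ∀ x, ∀ t ∈ Set.Ioc 0 T, u₁ x t = u₂ x t := by
  obtain ⟨B, hB⟩ := hbdd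
  have hIoo : ∀ x, ∀ t ∈ Set.Ioo 0 T, u₁ x t = u₂ x t := by
    intro x t ht
    have h₁ := exp_neg_le_exp_neg hc hu₀ hB hosc hsmooth₁ hsmooth₂ hflow₁ hflow₂ hcurv₁
      hinit₁ hinit₂ x ht
    have h₂ := exp_neg_le_exp_neg hc hu₀ hB hosc hsmooth₂ hsmooth₁ hflow₂ hflow₁ hcurv₂
      hinit₂ hinit₁ x ht
    rw [Real.exp_le_exp] at h₁ h₂
    linarith
  intro x t ht
  rcases ht.2.lt_or_eq with h | rfl
  · exact hIoo x t ⟨ht.1, h⟩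
  · have hcont : ∀ u : EuclideanSpace ℝ (Fin n) → ℝ → ℝ,
        ContDiffOn ℝ (⊤ : ℕ∞) (fun p : EuclideanSpace ℝ (Fin n) × ℝ => u p.1 p.2)
          (Set.univ ×ˢ Set.Ioc 0 t) →
        Filter.Tendsto (u x) (nhdsWithin t (Set.Ioo 0 t)) (nhds (u x t)) := by
      intro u hu
      have h : ContinuousOn (u x) (Set.Ioc 0 t) :=
        hu.continuousOn.comp (f := fun s : ℝ => (x, s)) (by fun_prop)
          fun s hs => ⟨Set.mem_univ _, hs⟩
      exact (h t ht).mono Set.Ioo_subset_Ioc_self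
    have : (nhdsWithin t (Set.Ioo 0 t)).NeBot := right_nhdsWithin_Ioo_neBot ht.1
    refine tendsto_nhds_unique (hcont u₁ hsmooth₁) ((hcont u₂ hsmooth₂).congr' ?_)
    filter_upwards [self_mem_nhdsWithin] with s hs using (hIoo x s hs).symm
end
end

section
/- Let u₀ : ℝⁿ → ℝ be a convex function with u₀(x) → +∞ as |x| → +∞ (a proper convex entire graph). Let u₁, u₂ : ℝⁿ × (0,T) → ℝ be two smooth solutions of the graphical mean curvature flow such that for each i = 1,2 and each t ∈ (0,T), the function uᵢ(·,t) is convex on ℝⁿ and uᵢ(x,t) → +∞ as |x| → +∞, and which both attain the initial data u₀, i.e., uᵢ(·,t) → u₀ locally uniformly as t → 0⁺. Then u₁ = u₂ on ℝⁿ × (0,T). -/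
open Real Filter Set

noncomputable section

open scoped RealInnerProductSpace

/-- A function with a minimum at `0` has vanishing first and nonnegative second derivative there. -/
lemma deriv_eq_zero_and_nonneg_of_min {φ φ' : ℝ → ℝ} {φ'' : ℝ} (hmin : ∀ s, φ 0 ≤ φ s)
    (h1 : ∀ s, HasDerivAt φ (φ' s) s) (h2 : HasDerivAt φ' φ'' 0) : φ' 0 = 0 ∧ 0 ≤ φ'' := by
  have hloc : IsLocalMin φ 0 := Filter.Eventually.of_forall hmin
  have h0 : φ' 0 = 0 := hloc.hasDerivAt_eq_zero (h1 0)
  refine ⟨h0, ?_⟩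
  by_contra! hneg
  have hd : deriv φ = φ' := funext fun s => (h1 s).deriv
  have hmax : IsLocalMax φ 0 :=
    isLocalMax_of_deriv_deriv_neg (by rw [hd, h2.deriv]; exact hneg) (by rw [hd, h0])
      (h1 0).continuousAt
  have hconst : φ =ᶠ[nhds 0] fun _ => φ 0 := by
    filter_upwards [hmax] with s hs using le_antisymm hs (hmin s)
  have hd0 : φ' =ᶠ[nhds 0] fun _ => (0 : ℝ) := by
    have := hconst.deriv
    rw [hd] at this
    simpa using this
  have : φ'' = 0 := (h2.congr_of_eventuallyEq hd0.symm).unique (hasDerivAt_const 0 0)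
  linarith

/-- A function on `[s, t]` that is minimal at the right end point has nonpositive derivative
there. -/
lemma deriv_nonpos_of_min_right {g : ℝ → ℝ} {g' s t : ℝ} (hst : s < t)
    (hg : HasDerivAt g g' t) (hmin : ∀ r ∈ Set.Icc s t, g t ≤ g r) : g' ≤ 0 := by
  have h := (hasDerivWithinAt_iff_tendsto_slope' (s := Set.Iio t) (by simp)).1
    hg.hasDerivWithinAt
  refine le_of_tendsto h ?_
  filter_upwards [Ioo_mem_nhdsLT hst] with r hr
  rw [slope_def_field]
  exact div_nonpos_of_nonneg_of_nonpos (by linarith [hmin r ⟨hr.1.le, hr.2.le⟩])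
    (by linarith [hr.2])

section Frame

variable {n : ℕ}

/-- The horizontal parts of the projections of the standard basis of `ℝⁿ × ℝ` to the tangent space
of a graph with gradient `a`. -/
def tangentFrame (a : EuclideanSpace ℝ (Fin n)) : Option (Fin n) → EuclideanSpace ℝ (Fin n)
  | none => (1 / (1 + ‖a‖ ^ 2)) • a
  | some i => EuclideanSpace.single i 1 - (a i / (1 + ‖a‖ ^ 2)) • a

lemma sum_apply_tangentFrame (a : EuclideanSpace ℝ (Fin n))
    (B : EuclideanSpace ℝ (Fin n) →L[ℝ] EuclideanSpace ℝ (Fin n) →L[ℝ] ℝ) :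
    ∑ k, B (tangentFrame a k) (tangentFrame a k) =
      ∑ i, ∑ j, ((if i = j then (1 : ℝ) else 0) - a i * a j / (1 + ∑ l, a l ^ 2)) *
        B (EuclideanSpace.single i 1) (EuclideanSpace.single j 1) := by
  have hA : ‖a‖ ^ 2 = ∑ l, a l ^ 2 := EuclideanSpace.real_norm_sq_eq a
  have hpos : (1 + ‖a‖ ^ 2) ≠ 0 := by positivity
  have ha : a = ∑ i, a i • EuclideanSpace.single i (1 : ℝ) := by
    ext j; simp [Pi.single_apply]
  have h1 : ∀ w, B w a = ∑ j, a j * B w (EuclideanSpace.single j 1) := fun w => by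
    conv_lhs => rw [ha]
    simp
  have h2 : ∀ w, B a w = ∑ j, a j * B (EuclideanSpace.single j 1) w := fun w => by
    conv_lhs => rw [ha]
    simp
  rw [← hA]
  set A := 1 + ‖a‖ ^ 2 with hAdef
  have hs : ∀ i : Fin n, B (tangentFrame a (some i)) (tangentFrame a (some i)) =
      B (EuclideanSpace.single i 1) (EuclideanSpace.single i 1)
        - (1 / A) * (a i * B (EuclideanSpace.single i 1) a)
        - (1 / A) * (a i * B a (EuclideanSpace.single i 1)) + a i ^ 2 * (B a a / A ^ 2) := by
    intro i
    simp only [tangentFrame, ← hAdef, map_sub, map_smul, sub_apply,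
      smul_apply, smul_eq_mul]
    field_simp
    ring
  rw [Fintype.sum_option]
  simp only [hs, Finset.sum_add_distrib, Finset.sum_sub_distrib, ← Finset.mul_sum,
    ← Finset.sum_mul, ← hA, ← h2]
  have hR : ∑ i, ∑ j, ((if i = j then (1 : ℝ) else 0) - a i * a j / A) *
        B (EuclideanSpace.single i 1) (EuclideanSpace.single j 1) =
      ∑ i, B (EuclideanSpace.single i 1) (EuclideanSpace.single i 1) - B a a / A := by
    simp only [sub_mul, Finset.sum_sub_distrib, ite_mul, one_mul, zero_mul]
    congr 1
    · simp
    · rw [h2 a, Finset.sum_div]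
      refine Finset.sum_congr rfl fun i _ => ?_
      rw [h1, Finset.mul_sum, Finset.sum_div]
      exact Finset.sum_congr rfl fun j _ => by ring
  rw [hR, ← h1 a]
  simp only [tangentFrame, ← hAdef, map_smul, smul_apply, smul_eq_mul]
  have : ‖a‖ ^ 2 = A - 1 := by rw [hAdef]; ring
  rw [this]
  field_simp
  ring

lemma sum_inner_tangentFrame (a b : EuclideanSpace ℝ (Fin n)) :
    ∑ k, (⟪tangentFrame a k, tangentFrame b k⟫ +
        ⟪a, tangentFrame a k⟫ * ⟪b, tangentFrame b k⟫) =
      n - 1 + (1 + ⟪a, b⟫) ^ 2 / ((1 + ‖a‖ ^ 2) * (1 + ‖b‖ ^ 2)) := by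
  have hA : ∑ l, a l ^ 2 = ‖a‖ ^ 2 := (EuclideanSpace.real_norm_sq_eq a).symm
  have hB : ∑ l, b l ^ 2 = ‖b‖ ^ 2 := (EuclideanSpace.real_norm_sq_eq b).symm
  have hab : ∑ l, a l * b l = ⟪a, b⟫ := by
    simp [PiLp.inner_apply, mul_comm]
  have hAp : (1 + ‖a‖ ^ 2) ≠ 0 := by positivity
  have hBp : (1 + ‖b‖ ^ 2) ≠ 0 := by positivity
  have hs : ∀ i : Fin n, ⟪tangentFrame a (some i), tangentFrame b (some i)⟫ +
        ⟪a, tangentFrame a (some i)⟫ * ⟪b, tangentFrame b (some i)⟫ =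
      1 - a i ^ 2 * (1 / (1 + ‖a‖ ^ 2)) - b i ^ 2 * (1 / (1 + ‖b‖ ^ 2)) +
        a i * b i * ((1 + ⟪a, b⟫) / ((1 + ‖a‖ ^ 2) * (1 + ‖b‖ ^ 2))) := by
    intro i
    simp only [tangentFrame, inner_sub_left, inner_sub_right, real_inner_smul_left,
      real_inner_smul_right, EuclideanSpace.inner_single_left, EuclideanSpace.inner_single_right,
      real_inner_self_eq_norm_sq, PiLp.single_apply]
    simp
    field_simp
    ring
  rw [Fintype.sum_option]
  simp only [hs, Finset.sum_add_distrib, Finset.sum_sub_distrib, ← Finset.sum_mul, hA, hB, hab]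
  simp only [tangentFrame, real_inner_smul_left, real_inner_smul_right,
      real_inner_self_eq_norm_sq]
  simp
  field_simp
  ring

end Frame

section Line

variable {n : ℕ}

lemma hasDerivAt_line {f : EuclideanSpace ℝ (Fin n) → ℝ} (hf : ContDiff ℝ 2 f)
    (x ξ : EuclideanSpace ℝ (Fin n)) (s : ℝ) :
    HasDerivAt (fun r : ℝ => f (x + r • ξ)) (fderiv ℝ f (x + s • ξ) ξ) s := by
  have h1 : HasDerivAt (fun r : ℝ => x + r • ξ) ξ s := by
    simpa using ((hasDerivAt_id s).smul_const ξ).const_add x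
  exact ((hf.differentiable (by norm_num) _).hasFDerivAt).comp_hasDerivAt s h1

lemma hasDerivAt_fderiv_line {f : EuclideanSpace ℝ (Fin n) → ℝ} (hf : ContDiff ℝ 2 f)
    (x ξ : EuclideanSpace ℝ (Fin n)) :
    HasDerivAt (fun r : ℝ => fderiv ℝ f (x + r • ξ) ξ) (fderiv ℝ (fderiv ℝ f) x ξ ξ) 0 := by
  have h1 : HasDerivAt (fun r : ℝ => x + r • ξ) ξ 0 := by
    simpa using ((hasDerivAt_id (0 : ℝ)).smul_const ξ).const_add x
  have hd : Differentiable ℝ (fderiv ℝ f) :=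
    (hf.fderiv_right (m := 1) (by norm_num)).differentiable (by norm_num)
  have h2 : HasFDerivAt (fderiv ℝ f) (fderiv ℝ (fderiv ℝ f) x) (x + (0 : ℝ) • ξ) := by
    simpa using (hd x).hasFDerivAt
  have h3 := h2.comp_hasDerivAt (0 : ℝ) h1
  exact h3.clm_apply (hasDerivAt_const (0 : ℝ) ξ) |>.congr_deriv (by simp)

/-- First and second derivative tests, along a line, for the penalized squared distance between
points of two graphs. -/
lemma two_point_derivative_test {f g : EuclideanSpace ℝ (Fin n) → ℝ} (hf : ContDiff ℝ 2 f)
    (hg : ContDiff ℝ 2 g) (ε : ℝ) (x y ξ η : EuclideanSpace ℝ (Fin n))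
    (hmin : ∀ s : ℝ, ‖x - y‖ ^ 2 + (f x - g y) ^ 2 + ε * (‖x + y‖ ^ 2 + (f x + g y) ^ 2) ≤
      ‖(x + s • ξ) - (y + s • η)‖ ^ 2 + (f (x + s • ξ) - g (y + s • η)) ^ 2 +
        ε * (‖(x + s • ξ) + (y + s • η)‖ ^ 2 + (f (x + s • ξ) + g (y + s • η)) ^ 2)) :
    ⟪x - y, ξ - η⟫ + (f x - g y) * (fderiv ℝ f x ξ - fderiv ℝ g y η) +
        ε * (⟪x + y, ξ + η⟫ + (f x + g y) * (fderiv ℝ f x ξ + fderiv ℝ g y η)) = 0 ∧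
    0 ≤ ‖ξ - η‖ ^ 2 + (fderiv ℝ f x ξ - fderiv ℝ g y η) ^ 2 +
        (f x - g y) * (fderiv ℝ (fderiv ℝ f) x ξ ξ - fderiv ℝ (fderiv ℝ g) y η η) +
        ε * (‖ξ + η‖ ^ 2 + (fderiv ℝ f x ξ + fderiv ℝ g y η) ^ 2 +
        (f x + g y) * (fderiv ℝ (fderiv ℝ f) x ξ ξ + fderiv ℝ (fderiv ℝ g) y η η)) := by
  have hnorm : ∀ (v w : EuclideanSpace ℝ (Fin n)) (s : ℝ),
      ‖v + s • w‖ ^ 2 = ‖v‖ ^ 2 + 2 * ⟪v, w⟫ * s + ‖w‖ ^ 2 * s ^ 2 := fun v w s => by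
    rw [norm_add_sq_real, real_inner_smul_right, norm_smul, mul_pow, Real.norm_eq_abs, sq_abs]
    ring
  have e1 : ∀ s : ℝ, (x + s • ξ) - (y + s • η) = (x - y) + s • (ξ - η) := fun s => by
    rw [smul_sub]; abel
  have e2 : ∀ s : ℝ, (x + s • ξ) + (y + s • η) = (x + y) + s • (ξ + η) := fun s => by
    rw [smul_add]; abel
  have hquad : ∀ (v w : EuclideanSpace ℝ (Fin n)) (s : ℝ),
      HasDerivAt (fun s : ℝ => ‖v + s • w‖ ^ 2) (2 * ⟪v, w⟫ + 2 * ‖w‖ ^ 2 * s) s := by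
    intro v w s
    simp only [hnorm]
    have := (((hasDerivAt_id s).const_mul (2 * ⟪v, w⟫)).const_add (‖v‖ ^ 2)).add
      (((hasDerivAt_id s).pow 2).const_mul (‖w‖ ^ 2))
    refine this.congr_deriv ?_
    simp
    ring
  have hlin : ∀ (v w : EuclideanSpace ℝ (Fin n)),
      HasDerivAt (fun s : ℝ => 2 * ⟪v, w⟫ + 2 * ‖w‖ ^ 2 * s) (2 * ‖w‖ ^ 2) 0 := by
    intro v w
    simpa using ((hasDerivAt_id (0 : ℝ)).const_mul (2 * ‖w‖ ^ 2)).const_add (2 * ⟪v, w⟫)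
  have hF := hasDerivAt_line hf x ξ
  have hG := hasDerivAt_line hg y η
  have hF' := hasDerivAt_fderiv_line hf x ξ
  have hG' := hasDerivAt_fderiv_line hg y η
  have d1 : ∀ s, HasDerivAt (fun s : ℝ =>
      ‖(x - y) + s • (ξ - η)‖ ^ 2 + (f (x + s • ξ) - g (y + s • η)) ^ 2 +
        ε * (‖(x + y) + s • (ξ + η)‖ ^ 2 + (f (x + s • ξ) + g (y + s • η)) ^ 2)) _ s := fun s =>
    ((hquad (x - y) (ξ - η) s).add (((hF s).sub (hG s)).pow 2)).add
      (((hquad (x + y) (ξ + η) s).add (((hF s).add (hG s)).pow 2)).const_mul ε)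
  have d2 := ((hlin (x - y) (ξ - η)).add
      ((((hF 0).sub (hG 0)).pow 1).mul (hF'.sub hG') |>.const_mul 2)).add
      (((hlin (x + y) (ξ + η)).add
        ((((hF 0).add (hG 0)).pow 1).mul (hF'.add hG') |>.const_mul 2)).const_mul ε)
  obtain ⟨h0, h2⟩ := deriv_eq_zero_and_nonneg_of_min (by simpa [e1, e2] using hmin) d1
    (d2.congr_of_eventuallyEq (Filter.Eventually.of_forall fun s => by
      simp [mul_assoc]))
  simp at h0 h2
  constructor
  · linarith
  · linarith

end Line

section Flow

variable {n : ℕ}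

lemma inner_gradient {f : EuclideanSpace ℝ (Fin n) → ℝ} (x ξ : EuclideanSpace ℝ (Fin n)) :
    ⟪gradient f x, ξ⟫ = fderiv ℝ f x ξ := by
  simp [gradient]

lemma mcfRHS_eq_sum {f : EuclideanSpace ℝ (Fin n) → ℝ} (hf : ContDiff ℝ 2 f)
    (x : EuclideanSpace ℝ (Fin n)) :
    mcfRHS n f x = ∑ k, fderiv ℝ (fderiv ℝ f) x (tangentFrame (gradient f x) k)
      (tangentFrame (gradient f x) k) := by
  have hd : Differentiable ℝ (fderiv ℝ f) :=
    (hf.fderiv_right (m := 1) (by norm_num)).differentiable (by norm_num)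
  have ha : ∀ i, pd n f i x = gradient f x i := fun i => by
    rw [pd, ← inner_gradient, EuclideanSpace.inner_single_right]
    simp
  have hb : ∀ i j, pd2 n f i j x = fderiv ℝ (fderiv ℝ f) x (EuclideanSpace.single i 1)
      (EuclideanSpace.single j 1) := fun i j => by
    simp only [pd2, pd]
    rw [fderiv_clm_apply (hd x) (differentiableAt_const _)]
    simp
  simp only [sum_apply_tangentFrame, mcfRHS, gradSq, ha, hb]

/-- The summed derivative tests at a minimum of the penalized squared distance between points of
two graphs. -/
lemma two_point_min {f g : EuclideanSpace ℝ (Fin n) → ℝ} (hf : ContDiff ℝ 2 f)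
    (hg : ContDiff ℝ 2 g) (ε : ℝ) (x y : EuclideanSpace ℝ (Fin n))
    (hmin : ∀ x' y', ‖x - y‖ ^ 2 + (f x - g y) ^ 2 + ε * (‖x + y‖ ^ 2 + (f x + g y) ^ 2) ≤
      ‖x' - y'‖ ^ 2 + (f x' - g y') ^ 2 + ε * (‖x' + y'‖ ^ 2 + (f x' + g y') ^ 2)) :
    ∃ a b : EuclideanSpace ℝ (Fin n), ∃ Θ : ℝ,
      Θ * ((1 + ‖a‖ ^ 2) * (1 + ‖b‖ ^ 2)) = (1 + ⟪a, b⟫) ^ 2 ∧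
      (x - y) + ε • (x + y) = -(((f x - g y) + ε * (f x + g y)) • a) ∧
      (x - y) - ε • (x + y) = -(((f x - g y) - ε * (f x + g y)) • b) ∧
      0 ≤ 2 - 2 * Θ + ε * (4 * n - 2 + 2 * Θ) + (f x - g y) * (mcfRHS n f x - mcfRHS n g y) +
        ε * ((f x + g y) * (mcfRHS n f x + mcfRHS n g y)) := by
  have key := fun ξ η => two_point_derivative_test hf hg ε x y ξ η fun s => hmin _ _
  refine ⟨gradient f x, gradient g y,
    (1 + ⟪gradient f x, gradient g y⟫) ^ 2 /
      ((1 + ‖gradient f x‖ ^ 2) * (1 + ‖gradient g y‖ ^ 2)),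
    div_mul_cancel₀ _ (by positivity), ?_, ?_, ?_⟩
  · rw [← sub_eq_zero]
    refine ext_inner_right ℝ fun ξ => ?_
    have := (key ξ 0).1
    simp only [map_zero, sub_zero, add_zero, ← inner_gradient] at this
    simp only [sub_neg_eq_add, inner_add_left, real_inner_smul_left, inner_zero_left] at *
    linarith
  · rw [← sub_eq_zero]
    refine ext_inner_right ℝ fun η => ?_
    have := (key 0 η).1
    simp only [map_zero, zero_sub, zero_add, ← inner_gradient] at this
    simp only [sub_neg_eq_add, inner_add_left, inner_sub_left, real_inner_smul_left,
      inner_zero_left, inner_neg_right] at *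
    linarith
  · set a := gradient f x
    set b := gradient g y
    have hsum := Finset.sum_nonneg fun k (_ : k ∈ Finset.univ) =>
      (key (tangentFrame a k) (tangentFrame b k)).2
    have hab := sum_inner_tangentFrame a b
    have haa := sum_inner_tangentFrame a a
    have hbb := sum_inner_tangentFrame b b
    rw [real_inner_self_eq_norm_sq, ← pow_two, div_self (by positivity)] at haa hbb
    rw [mcfRHS_eq_sum hf, mcfRHS_eq_sum hg]
    have hexp : ∀ k,
        ‖tangentFrame a k - tangentFrame b k‖ ^ 2 +
          (fderiv ℝ f x (tangentFrame a k) - fderiv ℝ g y (tangentFrame b k)) ^ 2 +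
          (f x - g y) * (fderiv ℝ (fderiv ℝ f) x (tangentFrame a k) (tangentFrame a k) -
            fderiv ℝ (fderiv ℝ g) y (tangentFrame b k) (tangentFrame b k)) +
          ε * (‖tangentFrame a k + tangentFrame b k‖ ^ 2 +
            (fderiv ℝ f x (tangentFrame a k) + fderiv ℝ g y (tangentFrame b k)) ^ 2 +
            (f x + g y) * (fderiv ℝ (fderiv ℝ f) x (tangentFrame a k) (tangentFrame a k) +
            fderiv ℝ (fderiv ℝ g) y (tangentFrame b k) (tangentFrame b k))) =
        (1 + ε) * (⟪tangentFrame a k, tangentFrame a k⟫ +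
          ⟪a, tangentFrame a k⟫ * ⟪a, tangentFrame a k⟫) +
        (1 + ε) * (⟪tangentFrame b k, tangentFrame b k⟫ +
          ⟪b, tangentFrame b k⟫ * ⟪b, tangentFrame b k⟫) +
        (2 * ε - 2) * (⟪tangentFrame a k, tangentFrame b k⟫ +
          ⟪a, tangentFrame a k⟫ * ⟪b, tangentFrame b k⟫) +
        ((f x - g y) + ε * (f x + g y)) *
          fderiv ℝ (fderiv ℝ f) x (tangentFrame a k) (tangentFrame a k) +
        (ε * (f x + g y) - (f x - g y)) *
          fderiv ℝ (fderiv ℝ g) y (tangentFrame b k) (tangentFrame b k) := fun k => by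
      rw [norm_sub_sq_real, norm_add_sq_real, ← inner_gradient, ← inner_gradient,
        real_inner_self_eq_norm_sq, real_inner_self_eq_norm_sq]
      ring
    have hsplit : ∀ (c₁ c₂ c₃ c₄ c₅ : ℝ) (F₁ F₂ F₃ F₄ F₅ : Option (Fin n) → ℝ),
        ∑ k, (c₁ * F₁ k + c₂ * F₂ k + c₃ * F₃ k + c₄ * F₄ k + c₅ * F₅ k) =
          c₁ * ∑ k, F₁ k + c₂ * ∑ k, F₂ k + c₃ * ∑ k, F₃ k + c₄ * ∑ k, F₄ k + c₅ * ∑ k, F₅ k := by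
      intros
      simp only [Finset.sum_add_distrib, Finset.mul_sum]
    rw [Finset.sum_congr rfl fun k _ => hexp k, hsplit, haa, hbb, hab] at hsum
    linarith

/-- The normals at a minimum of the penalized squared distance `d + ε S` are almost parallel. -/
lemma one_sub_cos_sq_le {d S m ε q Θ : ℝ} (hε : 0 < ε) (hε' : ε ≤ 1 / 16) (hq : 0 < q)
    (hd : q / 4 ≤ d) (hS : ε * S < q) (hm : m ^ 2 ≤ d * S)
    (hΘ : Θ * ((d + 2 * ε * m + ε ^ 2 * S) * (d - 2 * ε * m + ε ^ 2 * S)) =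
      (d - ε ^ 2 * S) ^ 2) : 1 - Θ ≤ 29 * ε := by
  by_contra! hlt
  have hd0 : 0 < d := by linarith
  set N := (d + 2 * ε * m + ε ^ 2 * S) * (d - 2 * ε * m + ε ^ 2 * S) with hN
  have h1 : (1 - Θ) * N = 4 * ε ^ 2 * (d * S - m ^ 2) := by
    rw [sub_mul, hΘ, hN]; ring
  have h2 : ε ^ 2 * S ≤ d / 4 := by nlinarith
  have h3 : 9 / 16 * d ^ 2 ≤ N := by
    have : N = (d - ε ^ 2 * S) ^ 2 + 4 * ε ^ 2 * (d * S - m ^ 2) := by rw [hN]; ring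
    have h4 : 0 ≤ 4 * ε ^ 2 * (d * S - m ^ 2) := mul_nonneg (by positivity) (by linarith)
    nlinarith
  have h5 : 29 * ε * (9 / 16 * d ^ 2) ≤ (1 - Θ) * N :=
    mul_le_mul hlt.le h3 (by positivity) (by nlinarith)
  have h6 : (1 - Θ) * N ≤ 4 * ε ^ 2 * (d * S) := by
    rw [h1]; nlinarith [mul_nonneg (sq_nonneg ε) (sq_nonneg m)]
  have h7 : 4 * ε ^ 2 * (d * S) ≤ 4 * ε * d * (4 * d) := by
    have : 4 * ε * d * (ε * S) ≤ 4 * ε * d * (4 * d) :=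
      mul_le_mul_of_nonneg_left (by linarith) (by positivity)
    linarith
  nlinarith [mul_pos hε (mul_pos hd0 hd0)]

/-- A classical solution of graphical mean curvature flow on `(0, T)`, continuous up to time
`0`. -/
structure IsGraphFlow (u : EuclideanSpace ℝ (Fin n) → ℝ → ℝ) (T : ℝ) : Prop where
  continuousOn : ContinuousOn (fun p : EuclideanSpace ℝ (Fin n) × ℝ => u p.1 p.2)
    (Set.univ ×ˢ Set.Ico 0 T)
  contDiff : ∀ t ∈ Set.Ioo 0 T, ContDiff ℝ 2 fun x => u x t
  hasDerivAt : ∀ x, ∀ t ∈ Set.Ioo 0 T, HasDerivAt (u x) (mcfRHS n (fun y => u y t) x) t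

lemma inner_add_mul_sq_le (v w : EuclideanSpace ℝ (Fin n)) (r s : ℝ) :
    (⟪v, w⟫ + r * s) ^ 2 ≤ (‖v‖ ^ 2 + r ^ 2) * (‖w‖ ^ 2 + s ^ 2) := by
  have h := abs_real_inner_le_norm v w
  have h1 : ⟪v, w⟫ ^ 2 ≤ (‖v‖ * ‖w‖) ^ 2 := sq_le_sq' (abs_le.1 h).1 (abs_le.1 h).2
  have h2 : ⟪v, w⟫ * (r * s) ≤ (‖v‖ * ‖w‖) * |r * s| :=
    (le_abs_self _).trans (by rw [abs_mul]; gcongr)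
  have h3 : 2 * ((‖v‖ * ‖w‖) * |r * s|) ≤ ‖v‖ ^ 2 * s ^ 2 + r ^ 2 * ‖w‖ ^ 2 := by
    rw [abs_mul, ← sq_abs r, ← sq_abs s]
    nlinarith [sq_nonneg (‖v‖ * |s| - |r| * ‖w‖)]
  nlinarith

/-- The squared distance between two graphical flows does not drop below its initial infimum, as
long as it stays above a quarter of it. -/
lemma dist_sq_ge_of_quarter {u v : EuclideanSpace ℝ (Fin n) → ℝ → ℝ} {T : ℝ}
    (hu : IsGraphFlow u T) (hv : IsGraphFlow v T) {s t₁ q : ℝ} (hs : 0 ≤ s) (hst : s ≤ t₁)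
    (ht₁ : t₁ < T) (hq : 0 < q)
    (h0 : ∀ x y, q ≤ ‖x - y‖ ^ 2 + (u x s - v y s) ^ 2)
    (h1 : ∀ t ∈ Set.Icc s t₁, ∀ x y, q / 4 ≤ ‖x - y‖ ^ 2 + (u x t - v y t) ^ 2)
    (x₁ y₁ : EuclideanSpace ℝ (Fin n)) : q ≤ ‖x₁ - y₁‖ ^ 2 + (u x₁ t₁ - v y₁ t₁) ^ 2 := by
  by_contra! hlt
  set C : ℝ := 8 * n + 128 with hC
  set Z : ℝ → EuclideanSpace ℝ (Fin n) × EuclideanSpace ℝ (Fin n) × ℝ → ℝ := fun ε p =>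
    ‖p.1 - p.2.1‖ ^ 2 + (u p.1 p.2.2 - v p.2.1 p.2.2) ^ 2 +
      ε * (‖p.1 + p.2.1‖ ^ 2 + (u p.1 p.2.2 + v p.2.1 p.2.2) ^ 2) + ε * (C * (p.2.2 - s)) with hZ
  obtain ⟨ε, hZε, hε, hε'⟩ : ∃ ε, Z ε (x₁, y₁, t₁) < q ∧ 0 < ε ∧ ε ≤ 1 / 16 := by
    have hc : Continuous fun ε => Z ε (x₁, y₁, t₁) := by
      simp only [hZ]; fun_prop
    have h : ∀ᶠ ε in nhdsWithin (0 : ℝ) (Set.Ioi 0), Z ε (x₁, y₁, t₁) < q :=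
      (hc.tendsto 0).mono_left nhdsWithin_le_nhds |>.eventually_lt_const (by simpa [hZ] using hlt)
    exact (h.and (Ioc_mem_nhdsGT (by norm_num : (0 : ℝ) < 1 / 16))).exists
  have hC0 : 0 < C := by positivity
  set R := Real.sqrt (q / (2 * ε)) with hR
  have hcoer : ∀ x y, ∀ t ∈ Set.Icc s t₁, Z ε (x, y, t) < q → ‖x‖ ≤ R ∧ ‖y‖ ≤ R := by
    intro x y t ht hlt
    have hp := parallelogram_law_with_norm ℝ x y
    have h2 : 0 ≤ ε * (C * (t - s)) :=
      mul_nonneg hε.le (mul_nonneg hC0.le (sub_nonneg.2 ht.1))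
    have h3 : ε * (2 * (‖x‖ ^ 2 + ‖y‖ ^ 2)) < q := by
      simp only [hZ] at hlt
      nlinarith [sq_nonneg (u x t - v y t), mul_nonneg hε.le (sq_nonneg (u x t + v y t)),
        mul_nonneg (by linarith : 0 ≤ 1 - ε) (sq_nonneg ‖x - y‖)]
    have h4 : ‖x‖ ^ 2 + ‖y‖ ^ 2 ≤ q / (2 * ε) := by
      rw [le_div_iff₀ (by positivity)]; linarith
    exact ⟨Real.le_sqrt_of_sq_le (by linarith [sq_nonneg ‖y‖]),
      Real.le_sqrt_of_sq_le (by linarith [sq_nonneg ‖x‖])⟩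
  set K : Set (EuclideanSpace ℝ (Fin n) × EuclideanSpace ℝ (Fin n) × ℝ) :=
    Metric.closedBall 0 R ×ˢ Metric.closedBall 0 R ×ˢ Set.Icc s t₁ with hK
  have hKc : IsCompact K :=
    (isCompact_closedBall _ _).prod ((isCompact_closedBall _ _).prod isCompact_Icc)
  have hmem : ∀ x y, ∀ t ∈ Set.Icc s t₁, Z ε (x, y, t) < q → (x, y, t) ∈ K := by
    intro x y t ht hlt
    have := hcoer x y t ht hlt
    exact ⟨by simpa using this.1, by simpa using this.2, ht⟩
  have hcont : ContinuousOn (Z ε) K := by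
    have hcu : ContinuousOn (fun p : EuclideanSpace ℝ (Fin n) × EuclideanSpace ℝ (Fin n) × ℝ =>
        u p.1 p.2.2) K :=
      hu.continuousOn.comp (f := fun p : EuclideanSpace ℝ (Fin n) × EuclideanSpace ℝ (Fin n) × ℝ =>
        (p.1, p.2.2)) (by fun_prop)
        fun p hp => ⟨trivial, hs.trans hp.2.2.1, hp.2.2.2.trans_lt ht₁⟩
    have hcv : ContinuousOn (fun p : EuclideanSpace ℝ (Fin n) × EuclideanSpace ℝ (Fin n) × ℝ =>
        v p.2.1 p.2.2) K :=
      hv.continuousOn.comp (f := fun p : EuclideanSpace ℝ (Fin n) × EuclideanSpace ℝ (Fin n) × ℝ =>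
        (p.2.1, p.2.2)) (by fun_prop)
        fun p hp => ⟨trivial, hs.trans hp.2.2.1, hp.2.2.2.trans_lt ht₁⟩
    have hdiff : Continuous fun p : EuclideanSpace ℝ (Fin n) × EuclideanSpace ℝ (Fin n) × ℝ =>
        ‖p.1 - p.2.1‖ ^ 2 := by fun_prop
    have hadd : Continuous fun p : EuclideanSpace ℝ (Fin n) × EuclideanSpace ℝ (Fin n) × ℝ =>
        ‖p.1 + p.2.1‖ ^ 2 := by fun_prop
    have htime : Continuous fun p : EuclideanSpace ℝ (Fin n) × EuclideanSpace ℝ (Fin n) × ℝ =>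
        ε * (C * (p.2.2 - s)) := by fun_prop
    exact ((hdiff.continuousOn.add ((hcu.sub hcv).pow 2)).add
      ((hadd.continuousOn.add ((hcu.add hcv).pow 2)).const_mul ε)).add htime.continuousOn
  obtain ⟨⟨x, y, t⟩, hpK, hpmin⟩ :=
    hKc.exists_isMinOn ⟨_, hmem x₁ y₁ t₁ ⟨hst, le_rfl⟩ hZε⟩ hcont
  have htI : t ∈ Set.Icc s t₁ := hpK.2.2
  have hZlt : Z ε (x, y, t) < q :=
    (hpmin (hmem x₁ y₁ t₁ ⟨hst, le_rfl⟩ hZε)).trans_lt hZε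
  have hglob : ∀ x' y', ∀ t' ∈ Set.Icc s t₁, Z ε (x, y, t) ≤ Z ε (x', y', t') := by
    intro x' y' t' ht'
    by_cases h : Z ε (x', y', t') < q
    · exact hpmin (hmem x' y' t' ht' h)
    · exact hZlt.le.trans (not_lt.1 h)
  have hsZ : ∀ r, 0 ≤ ε * (‖x + y‖ ^ 2 + r ^ 2) := fun r => by positivity
  have hts : s < t := by
    refine lt_of_le_of_ne htI.1 ?_
    rintro rfl
    have h2 := h0 x y
    have h3 := hsZ (u x s + v y s)
    simp only [hZ, sub_self, mul_zero, add_zero] at hZlt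
    linarith
  have htT : t ∈ Set.Ioo 0 T := ⟨hs.trans_lt hts, htI.2.trans_lt ht₁⟩
  obtain ⟨a, b, Θ, hΘ, hpa, hqb, hsec⟩ := two_point_min (hu.contDiff t htT) (hv.contDiff t htT) ε
    x y fun x' y' => by
      have := hglob x' y' t htI
      simp only [hZ] at this
      linarith
  set U := mcfRHS n (fun x => u x t) x
  set V := mcfRHS n (fun x => v x t) y
  have hdU := hu.hasDerivAt x t htT
  have hdV := hv.hasDerivAt y t htT
  have hdZ : HasDerivAt (fun r => Z ε (x, y, r)) (2 * (u x t - v y t) * (U - V) +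
      ε * (2 * (u x t + v y t) * (U + V)) + ε * C) t := by
    have := ((((hdU.sub hdV).pow 2).const_add (‖x - y‖ ^ 2)).add
      ((((hdU.add hdV).pow 2).const_add (‖x + y‖ ^ 2)).const_mul ε)).add
      ((((hasDerivAt_id t).sub_const s).const_mul C).const_mul ε)
    refine this.congr_deriv ?_
    simp [U, V]
  have htime := deriv_nonpos_of_min_right hts hdZ fun r hr =>
    hglob x y r ⟨hr.1, hr.2.trans htI.2⟩
  have hcos : 1 - Θ ≤ 29 * ε := by
    refine one_sub_cos_sq_le (d := ‖x - y‖ ^ 2 + (u x t - v y t) ^ 2)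
      (S := ‖x + y‖ ^ 2 + (u x t + v y t) ^ 2)
      (m := ⟪x - y, x + y⟫ + (u x t - v y t) * (u x t + v y t)) hε hε' hq (h1 t htI x y)
      ?_ (inner_add_mul_sq_le _ _ _ _) ?_
    · have h2 := h1 t htI x y
      have h3 : 0 ≤ ε * (C * (t - s)) :=
        mul_nonneg hε.le (mul_nonneg hC0.le (sub_nonneg.2 htI.1))
      simp only [hZ] at hZlt
      linarith
    · have e1 : ‖(x - y) + ε • (x + y)‖ ^ 2 = ‖x - y‖ ^ 2 + 2 * ε * ⟪x - y, x + y⟫ +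
          ε ^ 2 * ‖x + y‖ ^ 2 := by
        rw [norm_add_sq_real, real_inner_smul_right, norm_smul, mul_pow, Real.norm_eq_abs, sq_abs]
        ring
      have e2 : ‖(x - y) - ε • (x + y)‖ ^ 2 = ‖x - y‖ ^ 2 - 2 * ε * ⟪x - y, x + y⟫ +
          ε ^ 2 * ‖x + y‖ ^ 2 := by
        rw [norm_sub_sq_real, real_inner_smul_right, norm_smul, mul_pow, Real.norm_eq_abs, sq_abs]
        ring
      have e3 : ∀ X Y : EuclideanSpace ℝ (Fin n),
          ⟪X + ε • Y, X - ε • Y⟫ = ‖X‖ ^ 2 - ε ^ 2 * ‖Y‖ ^ 2 := fun X Y => by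
        rw [inner_add_left, inner_sub_right, inner_sub_right, real_inner_smul_right,
          real_inner_smul_right, real_inner_smul_left, real_inner_smul_left,
          real_inner_self_eq_norm_sq, real_inner_self_eq_norm_sq, real_inner_comm Y X]
        ring
      replace e3 := e3 (x - y) (x + y)
      rw [hpa, norm_neg, norm_smul, mul_pow, Real.norm_eq_abs, sq_abs] at e1
      rw [hqb, norm_neg, norm_smul, mul_pow, Real.norm_eq_abs, sq_abs] at e2
      rw [hpa, hqb, inner_neg_neg, real_inner_smul_left, real_inner_smul_right] at e3
      have f1 : ‖x - y‖ ^ 2 + (u x t - v y t) ^ 2 +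
          2 * ε * (⟪x - y, x + y⟫ + (u x t - v y t) * (u x t + v y t)) +
          ε ^ 2 * (‖x + y‖ ^ 2 + (u x t + v y t) ^ 2) =
            (u x t - v y t + ε * (u x t + v y t)) ^ 2 * (1 + ‖a‖ ^ 2) := by
        linear_combination -e1
      have f2 : ‖x - y‖ ^ 2 + (u x t - v y t) ^ 2 -
          2 * ε * (⟪x - y, x + y⟫ + (u x t - v y t) * (u x t + v y t)) +
          ε ^ 2 * (‖x + y‖ ^ 2 + (u x t + v y t) ^ 2) =
            (u x t - v y t - ε * (u x t + v y t)) ^ 2 * (1 + ‖b‖ ^ 2) := by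
        linear_combination -e2
      have f3 : ‖x - y‖ ^ 2 + (u x t - v y t) ^ 2 -
          ε ^ 2 * (‖x + y‖ ^ 2 + (u x t + v y t) ^ 2) =
            (u x t - v y t + ε * (u x t + v y t)) * (u x t - v y t - ε * (u x t + v y t)) *
              (1 + ⟪a, b⟫) := by
        linear_combination -e3
      rw [f1, f2, f3, mul_pow, ← hΘ]
      ring
  have hΘ1 : Θ ≤ 1 := by
    have h2 := inner_add_mul_sq_le a b 1 1
    have h3 : 0 < (1 + ‖a‖ ^ 2) * (1 + ‖b‖ ^ 2) := by positivity
    refine le_of_mul_le_mul_right ?_ h3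
    rw [hΘ]
    linarith
  have : ε * (4 * n - 2 + 2 * Θ) ≤ ε * (4 * n) := mul_le_mul_of_nonneg_left (by linarith) hε.le
  have : ε * C = 8 * (ε * n) + 128 * ε := by rw [hC]; ring
  nlinarith

/-- The graph at time `t₁` stays within distance `√((2n+1)(t₁ - s))` of the graph at time `s`. -/
lemma exists_dist_sq_le {u : EuclideanSpace ℝ (Fin n) → ℝ → ℝ} {T : ℝ}
    (hu : IsGraphFlow u T) {s t₁ : ℝ} (hs : 0 ≤ s) (hst : s ≤ t₁) (ht₁ : t₁ < T)
    (x₁ : EuclideanSpace ℝ (Fin n)) :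
    ∃ x, ‖x - x₁‖ ^ 2 + (u x s - u x₁ t₁) ^ 2 ≤ (2 * n + 1) * (t₁ - s) := by
  set h := u x₁ t₁ with hh
  set Z : EuclideanSpace ℝ (Fin n) × ℝ → ℝ := fun p =>
    ‖p.1 - x₁‖ ^ 2 + (u p.1 p.2 - h) ^ 2 + (2 * n + 1) * (p.2 - s) with hZ
  set R := Real.sqrt ((2 * n + 1) * (t₁ - s)) with hR
  have hZ₁ : Z (x₁, t₁) = (2 * n + 1) * (t₁ - s) := by simp [hZ, hh]
  set K : Set (EuclideanSpace ℝ (Fin n) × ℝ) := Metric.closedBall x₁ R ×ˢ Set.Icc s t₁ with hK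
  have hKc : IsCompact K := (isCompact_closedBall _ _).prod isCompact_Icc
  have hmem₁ : (x₁, t₁) ∈ K := ⟨by simp [hR, Real.sqrt_nonneg], hst, le_rfl⟩
  have hmem : ∀ x, ∀ t ∈ Set.Icc s t₁, Z (x, t) ≤ Z (x₁, t₁) → (x, t) ∈ K := by
    intro x t ht hle
    refine ⟨?_, ht⟩
    rw [mem_closedBall_iff_norm]
    refine Real.le_sqrt_of_sq_le ?_
    rw [hZ₁] at hle
    simp only [hZ] at hle
    have : 0 ≤ (2 * (n : ℝ) + 1) * (t - s) := mul_nonneg (by positivity) (sub_nonneg.2 ht.1)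
    linarith [sq_nonneg (u x t - h)]
  have hcont : ContinuousOn Z K := by
    have hcu : ContinuousOn (fun p : EuclideanSpace ℝ (Fin n) × ℝ => u p.1 p.2) K :=
      hu.continuousOn.mono fun p hp => ⟨trivial, hs.trans hp.2.1, hp.2.2.trans_lt ht₁⟩
    simp only [hZ]
    fun_prop
  obtain ⟨⟨x, t⟩, hpK, hpmin⟩ := hKc.exists_isMinOn ⟨_, hmem₁⟩ hcont
  have htI : t ∈ Set.Icc s t₁ := hpK.2
  have hle : Z (x, t) ≤ Z (x₁, t₁) := hpmin hmem₁
  have hglob : ∀ x', ∀ t' ∈ Set.Icc s t₁, Z (x, t) ≤ Z (x', t') := by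
    intro x' t' ht'
    by_cases h' : Z (x', t') ≤ Z (x₁, t₁)
    · exact hpmin (hmem x' t' ht' h')
    · exact hle.trans (not_le.1 h').le
  rcases htI.1.eq_or_lt with rfl | hts
  · refine ⟨x, ?_⟩
    rw [hZ₁] at hle
    simpa [hZ] using hle
  exfalso
  have htT : t ∈ Set.Ioo 0 T := ⟨hs.trans_lt hts, htI.2.trans_lt ht₁⟩
  have hf := hu.contDiff t htT
  have key := fun ξ => (two_point_derivative_test hf (contDiff_const (c := h)) 0 x x₁ ξ 0
    fun r => by
      have := hglob (x + r • ξ) t htI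
      simp only [hZ] at this
      simp only [smul_zero, add_zero, zero_mul]
      linarith).2
  set a := gradient (fun x => u x t) x with ha
  have hsum := Finset.sum_nonneg fun k (_ : k ∈ Finset.univ) => key (tangentFrame a k)
  have haa := sum_inner_tangentFrame a a
  rw [real_inner_self_eq_norm_sq, ← pow_two, div_self (by positivity)] at haa
  have hexp : ∀ k, ⟪tangentFrame a k, tangentFrame a k⟫ +
      ⟪a, tangentFrame a k⟫ * ⟪a, tangentFrame a k⟫ = ‖tangentFrame a k‖ ^ 2 +
        (fderiv ℝ (fun x => u x t) x (tangentFrame a k)) ^ 2 := fun k => by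
    rw [real_inner_self_eq_norm_sq, ha, inner_gradient, pow_two (fderiv ℝ _ x _)]
  simp only [hexp] at haa
  have hsplit : ∀ (c : ℝ) (F₁ F₂ : Option (Fin n) → ℝ),
      ∑ k, (F₁ k + c * F₂ k) = ∑ k, F₁ k + c * ∑ k, F₂ k := by
    intros
    simp only [Finset.sum_add_distrib, Finset.mul_sum]
  simp only [map_zero, sub_zero, zero_mul, add_zero, fderiv_fun_const, Pi.zero_apply,
    hsplit] at hsum
  rw [haa, ha, ← mcfRHS_eq_sum hf] at hsum
  have hdZ : HasDerivAt (fun r => Z (x, r)) (2 * (u x t - h) * mcfRHS n (fun x => u x t) x +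
      (2 * n + 1)) t := by
    have := ((((hu.hasDerivAt x t htT).sub_const h).pow 2).const_add (‖x - x₁‖ ^ 2)).add
      (((hasDerivAt_id t).sub_const s).const_mul (2 * (n : ℝ) + 1))
    refine this.congr_deriv ?_
    simp
  have htime := deriv_nonpos_of_min_right hts hdZ fun r hr =>
    hglob x r ⟨hr.1, hr.2.trans htI.2⟩
  linarith

lemma quarter_le_dist_sq_of_perturb {x y x' y' : EuclideanSpace ℝ (Fin n)} {a b a' b' q : ℝ}
    (h : q ≤ ‖x' - y'‖ ^ 2 + (a' - b') ^ 2) (hx : ‖x' - x‖ ^ 2 + (a' - a) ^ 2 ≤ q / 16)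
    (hy : ‖y' - y‖ ^ 2 + (b' - b) ^ 2 ≤ q / 16) : q / 4 ≤ ‖x - y‖ ^ 2 + (a - b) ^ 2 := by
  have hq : 0 ≤ q := by nlinarith [sq_nonneg ‖x' - x‖, sq_nonneg (a' - a)]
  have key : ∀ (z : EuclideanSpace ℝ (Fin n)) (r : ℝ),
      ‖WithLp.toLp 2 (z, r)‖ ^ 2 = ‖z‖ ^ 2 + r ^ 2 := fun z r => by
    rw [WithLp.prod_norm_sq_eq_of_L2]; simp
  rw [← key] at *
  have h16 : ∀ w : WithLp 2 (EuclideanSpace ℝ (Fin n) × ℝ), ‖w‖ ^ 2 ≤ q / 16 →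
      ‖w‖ ≤ √q / 4 := fun w hw => by
    refine le_of_sq_le_sq ?_ (by positivity)
    rw [div_pow, sq_sqrt hq]; linarith
  have htri : ‖WithLp.toLp 2 (x' - y', a' - b')‖ ≤ ‖WithLp.toLp 2 (x' - x, a' - a)‖ +
      ‖WithLp.toLp 2 (x - y, a - b)‖ + ‖WithLp.toLp 2 (y' - y, b' - b)‖ := by
    have : WithLp.toLp 2 (x' - y', a' - b') = WithLp.toLp 2 (x' - x, a' - a) +
        WithLp.toLp 2 (x - y, a - b) - WithLp.toLp 2 (y' - y, b' - b) := by
      rw [← WithLp.toLp_add, ← WithLp.toLp_sub]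
      refine congrArg _ (Prod.ext ?_ ?_)
      · change x' - y' = x' - x + (x - y) - (y' - y)
        abel
      · change a' - b' = a' - a + (a - b) - (b' - b)
        ring
    rw [this]
    exact (norm_sub_le _ _).trans (by gcongr; exact norm_add_le _ _)
  have h1 := h16 _ hx
  have h2 := h16 _ hy
  have h3 : √q ≤ ‖WithLp.toLp 2 (x' - y', a' - b')‖ := by
    rw [← sqrt_sq (norm_nonneg (WithLp.toLp 2 (x' - y', a' - b')))]
    exact sqrt_le_sqrt h
  have h4 : √q / 2 ≤ ‖WithLp.toLp 2 (x - y, a - b)‖ := by linarith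
  have h5 := pow_le_pow_left₀ (by positivity) h4 2
  rw [div_pow, sq_sqrt hq] at h5
  linarith

/-- The squared distance between two graphical flows does not drop below its initial infimum. -/
lemma dist_sq_ge {u v : EuclideanSpace ℝ (Fin n) → ℝ → ℝ} {T q : ℝ}
    (hu : IsGraphFlow u T) (hv : IsGraphFlow v T) (hq : 0 < q)
    (h0 : ∀ x y, q ≤ ‖x - y‖ ^ 2 + (u x 0 - v y 0) ^ 2) {t : ℝ} (ht : t ∈ Set.Ico 0 T)
    (x y : EuclideanSpace ℝ (Fin n)) : q ≤ ‖x - y‖ ^ 2 + (u x t - v y t) ^ 2 := by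
  set τ : ℝ := q / 16 / (2 * n + 1) with hτ
  have hτ0 : 0 < τ := by positivity
  have hτq : (2 * n + 1) * τ = q / 16 := by rw [hτ]; field_simp
  have key : ∀ N : ℕ, ∀ t ∈ Set.Ico 0 T, t ≤ N * τ → ∀ x y,
      q ≤ ‖x - y‖ ^ 2 + (u x t - v y t) ^ 2 := by
    intro N
    induction N with
    | zero =>
      intro t ht htN
      obtain rfl : t = 0 := le_antisymm (by simpa using htN) ht.1
      exact h0
    | succ N ih =>
      intro t ht htN x y
      push_cast at htN
      have hs0 : 0 ≤ max (t - τ) 0 := le_max_right _ _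
      have hst : max (t - τ) 0 ≤ t := max_le (by linarith) ht.1
      have hts : t - τ ≤ max (t - τ) 0 := le_max_left _ _
      have hs := ih (max (t - τ) 0) ⟨hs0, hst.trans_lt ht.2⟩
        (max_le (by linarith) (by positivity))
      refine dist_sq_ge_of_quarter hu hv hs0 hst ht.2 hq hs (fun r hr x y => ?_) x y
      have hr' : (2 * n + 1) * (r - max (t - τ) 0) ≤ q / 16 := by
        rw [← hτq]
        exact mul_le_mul_of_nonneg_left (by linarith [hr.2]) (by positivity)
      obtain ⟨x', hx'⟩ := exists_dist_sq_le hu hs0 hr.1 (hr.2.trans_lt ht.2) x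
      obtain ⟨y', hy'⟩ := exists_dist_sq_le hv hs0 hr.1 (hr.2.trans_lt ht.2) y
      exact quarter_le_dist_sq_of_perturb (hs x' y') (hx'.trans hr') (hy'.trans hr')
  obtain ⟨N, hN⟩ := exists_nat_ge (t / τ)
  exact key N t ht ((div_le_iff₀ hτ0).1 hN) x y

lemma mcfRHS_dilation {f : EuclideanSpace ℝ (Fin n) → ℝ} (h : ℝ) {l : ℝ} (hl : 0 < l)
    (x : EuclideanSpace ℝ (Fin n)) :
    mcfRHS n (fun x => l * (f (l⁻¹ • x) - h) + h) x = l⁻¹ * mcfRHS n f (l⁻¹ • x) := by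
  have h1 : ∀ i x, pd n (fun x => l * (f (l⁻¹ • x) - h) + h) i x = pd n f i (l⁻¹ • x) := by
    intro i x
    rw [pd, pd, fderiv_add_const]
    change fderiv ℝ (l • fun x => f (l⁻¹ • x) - h) x _ = _
    rw [fderiv_const_smul_field, Pi.smul_apply, fderiv_sub_const, fderiv_comp_smul, smul_smul,
      mul_inv_cancel₀ hl.ne', one_smul]
  have h2 : ∀ i j, pd2 n (fun x => l * (f (l⁻¹ • x) - h) + h) i j x =
      l⁻¹ * pd2 n f i j (l⁻¹ • x) := by
    intro i j
    simp only [pd2, h1]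
    rw [pd, fderiv_comp_smul (f := fun y => pd n f j y)]
    rfl
  simp only [mcfRHS, gradSq, h1, h2, Finset.mul_sum]
  refine Finset.sum_congr rfl fun i _ => Finset.sum_congr rfl fun j _ => ?_
  ring

/-- Parabolic dilation of a graphical flow about the point `(0, h)`. -/
lemma IsGraphFlow.dilation {u : EuclideanSpace ℝ (Fin n) → ℝ → ℝ} {T : ℝ}
    (hu : IsGraphFlow u T) (h : ℝ) {l : ℝ} (hl : 1 ≤ l) :
    IsGraphFlow (fun x t => l * (u (l⁻¹ • x) (t / l ^ 2) - h) + h) T := by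
  have hl0 : 0 < l := by linarith
  have hle : ∀ t, 0 ≤ t → t / l ^ 2 ≤ t := fun t ht =>
    div_le_self ht (one_le_pow₀ hl)
  refine ⟨?_, fun t ht => ?_, fun x t ht => ?_⟩
  · have hc : Continuous fun p : EuclideanSpace ℝ (Fin n) × ℝ => (l⁻¹ • p.1, p.2 / l ^ 2) := by
      fun_prop
    have := hu.continuousOn.comp hc.continuousOn (s := Set.univ ×ˢ Set.Ico 0 T)
      fun p hp => ⟨Set.mem_univ _, div_nonneg hp.2.1 (by positivity),
        (hle _ hp.2.1).trans_lt hp.2.2⟩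
    exact ((this.sub continuousOn_const).const_mul l).add continuousOn_const
  · have := hu.contDiff (t / l ^ 2)
      ⟨div_pos ht.1 (by positivity), (hle _ ht.1.le).trans_lt ht.2⟩
    exact (contDiff_const.mul ((this.comp (contDiff_const_smul _)).sub contDiff_const)).add
      contDiff_const
  · rw [mcfRHS_dilation h hl0 (f := fun y => u y (t / l ^ 2))]
    have h1 := hu.hasDerivAt (l⁻¹ • x) (t / l ^ 2)
      ⟨div_pos ht.1 (by positivity), (hle _ ht.1.le).trans_lt ht.2⟩
    have h2 := (((h1.comp t ((hasDerivAt_id t).div_const (l ^ 2))).sub_const h).const_mul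
      l).add_const h
    refine h2.congr_deriv ?_
    field_simp

lemma dilation_le {u₀ : EuclideanSpace ℝ (Fin n) → ℝ} (hconv : ConvexOn ℝ Set.univ u₀) {M l : ℝ}
    (hM : ∀ z, ‖z‖ ≤ 1 → u₀ z ≤ M) (hl : 1 < l) {x y : EuclideanSpace ℝ (Fin n)}
    (hxy : ‖x - y‖ ≤ l - 1) : l * (u₀ (l⁻¹ • x) - (M + 1)) + (M + 1) ≤ u₀ y - (l - 1) := by
  have hl0 : 0 < l := by linarith
  have hl1 : 0 < l - 1 := by linarith
  have hz := hM ((l - 1)⁻¹ • (x - y)) (by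
    rw [norm_smul, norm_inv, Real.norm_of_nonneg hl1.le]
    exact inv_mul_le_one_of_le₀ hxy hl1.le)
  have hc := hconv.2 (Set.mem_univ y) (Set.mem_univ ((l - 1)⁻¹ • (x - y)))
    (show 0 ≤ l⁻¹ by positivity) (show 0 ≤ l⁻¹ * (l - 1) by positivity) (by field_simp; ring)
  have hx : l⁻¹ • y + (l⁻¹ * (l - 1)) • (l - 1)⁻¹ • (x - y) = l⁻¹ • x := by
    rw [smul_smul, mul_assoc, mul_inv_cancel₀ hl1.ne', mul_one, ← smul_add]
    congr 1
    abel
  rw [hx, smul_eq_mul, smul_eq_mul, mul_assoc, ← mul_add, inv_mul_eq_div,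
    le_div_iff₀ hl0] at hc
  nlinarith

/-- Graphical flows with the same convex initial data are ordered. -/
lemma IsGraphFlow.le {u v : EuclideanSpace ℝ (Fin n) → ℝ → ℝ} {T : ℝ}
    (hu : IsGraphFlow u T) (hv : IsGraphFlow v T) (h0 : ∀ x, u x 0 = v x 0)
    (hconv : ConvexOn ℝ Set.univ fun x => u x 0) (x : EuclideanSpace ℝ (Fin n)) {t : ℝ}
    (ht : t ∈ Set.Ioo 0 T) : u x t ≤ v x t := by
  obtain ⟨M, hM⟩ : ∃ M, ∀ z : EuclideanSpace ℝ (Fin n), ‖z‖ ≤ 1 → u z 0 ≤ M := by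
    obtain ⟨M, hM⟩ := (isCompact_closedBall (0 : EuclideanSpace ℝ (Fin n)) 1).bddAbove_image
      ((hconv.continuousOn isOpen_univ).mono (Set.subset_univ _))
    exact ⟨M, fun z hz => hM ⟨z, by simpa using hz, rfl⟩⟩
  have hlt : ∀ l : ℝ, 1 < l → l * (u (l⁻¹ • x) (t / l ^ 2) - (M + 1)) + (M + 1) ≤ v x t := by
    intro l hl
    have hw := hu.dilation (M + 1) hl.le
    set w := fun (x : EuclideanSpace ℝ (Fin n)) t =>
      l * (u (l⁻¹ • x) (t / l ^ 2) - (M + 1)) + (M + 1)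
    have hw0 : ∀ x y, ‖x - y‖ ≤ l - 1 → w x 0 ≤ v y 0 - (l - 1) := fun x y hxy => by
      simpa [w, ← h0] using dilation_le hconv hM hl hxy
    have hsep : ∀ s ∈ Set.Ico 0 T, v x s - w x s ≠ 0 := by
      intro s hs h
      have := dist_sq_ge hw hv (q := (l - 1) ^ 2) (by nlinarith) (fun x y => ?_) hs x x
      · rw [sub_self, norm_zero, show w x s = v x s by linarith, sub_self] at this
        nlinarith
      · rcases le_total ‖x - y‖ (l - 1) with h | h
        · nlinarith [hw0 x y h, sq_nonneg ‖x - y‖]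
        · nlinarith [sq_nonneg (w x 0 - v y 0)]
    change w x t ≤ v x t
    by_contra! hcon
    have hslice : ∀ {z : EuclideanSpace ℝ (Fin n) → ℝ → ℝ}, IsGraphFlow z T →
        ContinuousOn (z x) (Set.Icc 0 t) := fun hz =>
      hz.continuousOn.comp (f := fun s => (x, s)) (by fun_prop)
        fun s hs => ⟨Set.mem_univ _, hs.1, hs.2.trans_lt ht.2⟩
    obtain ⟨s, hs, hs0⟩ := intermediate_value_Icc' ht.1.le ((hslice hv).sub (hslice hw))
      (show (0 : ℝ) ∈ Set.Icc _ _ from ⟨by simpa using hcon.le,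
        by have := hw0 x x (by simpa using hl.le); simp only [Pi.sub_apply]; linarith⟩)
    exact hsep s ⟨hs.1, hs.2.trans_lt ht.2⟩ hs0
  have hcont : ContinuousAt (fun p : EuclideanSpace ℝ (Fin n) × ℝ => u p.1 p.2) (x, t) :=
    hu.continuousOn.continuousAt (prod_mem_nhds Filter.univ_mem (Ico_mem_nhds ht.1 ht.2))
  have hpath : ContinuousAt (fun l : ℝ => (l⁻¹ • x, t / l ^ 2)) 1 := by
    fun_prop (disch := norm_num)
  have hcomp : ContinuousAt (fun l : ℝ => u (l⁻¹ • x) (t / l ^ 2)) 1 :=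
    ContinuousAt.comp (g := fun p : EuclideanSpace ℝ (Fin n) × ℝ => u p.1 p.2)
      (f := fun l : ℝ => (l⁻¹ • x, t / l ^ 2)) (by simpa using hcont) hpath
  have hlim : ContinuousAt
      (fun l : ℝ => l * (u (l⁻¹ • x) (t / l ^ 2) - (M + 1)) + (M + 1)) 1 :=
    (continuousAt_id.mul (hcomp.sub continuousAt_const)).add continuousAt_const
  have hle := le_of_tendsto (hlim.tendsto.mono_left (nhdsWithin_le_nhds (s := Set.Ioi 1)))
    (Filter.eventually_of_mem self_mem_nhdsWithin hlt)
  simpa using hle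

/-- A smooth solution attaining its initial data extends continuously to time `0`. -/
lemma IsMCFSolution.isGraphFlow {u : EuclideanSpace ℝ (Fin n) → ℝ → ℝ} {T : ℝ}
    {u₀ : EuclideanSpace ℝ (Fin n) → ℝ} (hflow : IsMCFSolution n u (Set.Ioo 0 T))
    (hsmooth : ContDiffOn ℝ (⊤ : ℕ∞) (fun p : EuclideanSpace ℝ (Fin n) × ℝ => u p.1 p.2)
      (Set.univ ×ˢ Set.Ioo 0 T)) (hu₀ : Continuous u₀)
    (hinit : TendstoLocallyUniformly (fun t x => u x t) u₀ (nhdsWithin 0 (Set.Ioi 0))) :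
    IsGraphFlow (fun x t => if t ≤ 0 then u₀ x else u x t) T := by
  have hat : ∀ x, ∀ t ∈ Set.Ioo 0 T,
      ContDiffAt ℝ (⊤ : ℕ∞) (fun p : EuclideanSpace ℝ (Fin n) × ℝ => u p.1 p.2) (x, t) :=
    fun x t ht => hsmooth.contDiffAt (prod_mem_nhds Filter.univ_mem (Ioo_mem_nhds ht.1 ht.2))
  refine ⟨?_, fun t ht => ?_, fun x t ht => ?_⟩
  · rintro ⟨x, t⟩ ⟨-, ht⟩
    rcases ht.1.eq_or_lt with h | h
    · obtain rfl : 0 = t := h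
      refine ContinuousAt.continuousWithinAt (Metric.continuousAt_iff'.2 fun ε hε => ?_)
      obtain ⟨N, hN, hNε⟩ := Metric.tendstoLocallyUniformly_iff.1 hinit (ε / 2) (half_pos hε) x
      rw [eventually_nhdsWithin_iff] at hNε
      have hc := Metric.continuousAt_iff'.1 (hu₀.continuousAt (x := x)) (ε / 2) (half_pos hε)
      filter_upwards [((Filter.eventually_of_mem hN fun _ h => h).and hc).prod_nhds hNε] with p hp
      obtain ⟨⟨hpN, hpc⟩, hpt⟩ := hp
      simp only [le_refl, if_true]
      split_ifs with hp0
      · linarith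
      · have h1 := hpt (not_le.1 hp0) p.1 hpN
        rw [dist_comm] at h1
        linarith [dist_triangle (u p.1 p.2) (u₀ p.1) (u₀ x)]
    · refine ContinuousAt.continuousWithinAt
        ((hat x t ⟨h, ht.2⟩).continuousAt.congr ?_)
      filter_upwards [prod_mem_nhds Filter.univ_mem (Ioi_mem_nhds h)] with p hp
      exact (if_neg (not_le.2 hp.2)).symm
  · simp only [not_le.2 ht.1, if_false]
    refine contDiff_iff_contDiffAt.2 fun x => ?_
    have h2 : ContDiffAt ℝ 2 (fun p : EuclideanSpace ℝ (Fin n) × ℝ => u p.1 p.2) (x, t) :=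
      (hat x t ht).of_le (WithTop.coe_le_coe.2 (le_top : (2 : ℕ∞) ≤ ⊤))
    exact h2.comp x (contDiff_id.prodMk contDiff_const).contDiffAt
  · simp only [not_le.2 ht.1, if_false]
    rw [← hflow x t ht]
    have hd : DifferentiableAt ℝ (u x) t :=
      ((hat x t ht).differentiableAt (by simp)).comp t
        (f := fun s => (x, s)) (by fun_prop)
    refine hd.hasDerivAt.congr_of_eventuallyEq ?_
    filter_upwards [Ioi_mem_nhds ht.1] with s hs
    exact if_neg (not_le.2 hs)

end Flow

/-- **Theorem 5.1 (Uniqueness of convex entire graph solutions).**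
Let `u₀ : ℝⁿ → ℝ` be convex and proper (`u₀ x → +∞` as `|x| → +∞`). Two smooth
entire-graph MCF solutions on `ℝⁿ × (0,T)` which are convex and proper at each
time and attain the same initial data `u₀` coincide. -/
theorem mcf_uniqueness_convex (n : ℕ) (T : ℝ) (hT : 0 < T)
    (u₀ : EuclideanSpace ℝ (Fin n) → ℝ)
    (hconv₀ : ConvexOn ℝ Set.univ u₀)
    (hproper₀ : Filter.Tendsto u₀ (Filter.cocompact _) Filter.atTop)
    (u₁ u₂ : EuclideanSpace ℝ (Fin n) → ℝ → ℝ)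
    (hsmooth₁ : ContDiffOn ℝ (⊤ : ℕ∞) (fun p : EuclideanSpace ℝ (Fin n) × ℝ => u₁ p.1 p.2)
      (Set.univ ×ˢ Set.Ioo 0 T))
    (hsmooth₂ : ContDiffOn ℝ (⊤ : ℕ∞) (fun p : EuclideanSpace ℝ (Fin n) × ℝ => u₂ p.1 p.2)
      (Set.univ ×ˢ Set.Ioo 0 T))
    (hflow₁ : IsMCFSolution n u₁ (Set.Ioo 0 T))
    (hflow₂ : IsMCFSolution n u₂ (Set.Ioo 0 T))
    (hconv₁ : ∀ t ∈ Set.Ioo 0 T, ConvexOn ℝ Set.univ (fun x => u₁ x t))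
    (hconv₂ : ∀ t ∈ Set.Ioo 0 T, ConvexOn ℝ Set.univ (fun x => u₂ x t))
    (hproper₁ : ∀ t ∈ Set.Ioo 0 T,
      Filter.Tendsto (fun x => u₁ x t) (Filter.cocompact _) Filter.atTop)
    (hproper₂ : ∀ t ∈ Set.Ioo 0 T,
      Filter.Tendsto (fun x => u₂ x t) (Filter.cocompact _) Filter.atTop)
    (hinit₁ : TendstoLocallyUniformly (fun t x => u₁ x t) u₀ (nhdsWithin 0 (Set.Ioi 0)))
    (hinit₂ : TendstoLocallyUniformly (fun t x => u₂ x t) u₀ (nhdsWithin 0 (Set.Ioi 0))) :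
    ∀ x, ∀ t ∈ Set.Ioo 0 T, u₁ x t = u₂ x t := by
  intro x t ht
  have hu₀ : Continuous u₀ := continuousOn_univ.1 (hconv₀.continuousOn isOpen_univ)
  have h₁ := hflow₁.isGraphFlow hsmooth₁ hu₀ hinit₁
  have h₂ := hflow₂.isGraphFlow hsmooth₂ hu₀ hinit₂
  have h₁₂ := h₁.le h₂ (by simp) (by simpa using hconv₀) x ht
  have h₂₁ := h₂.le h₁ (by simp) (by simpa using hconv₀) x ht
  simp only [not_le.2 ht.1, if_false] at h₁₂ h₂₁
  exact le_antisymm h₁₂ h₂₁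
end
end
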